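/- Let (R,m) be an excellent Noetherian local ring of dimension at least 2 that is equidimensional and has no embedded primes, and let E be the injective hull of the residue field R/m. Then lic(0,E) = E. -/

import Mathlib

/- # Liftable integral closure: core definitions

Free $R$-modules are modeled as `ι →₀ R`, and the symmetric algebra of `ι →₀ R`
is modeled as `MvPolynomial ι R`, with the canonical degree-one embedding sending
the basis vector at `i` to the variable `X i`. -/

noncomputable section

open scoped TensorProduct

namespace LIC

variable (R : Type*) [CommRing R]

/-- The canonical embedding of the free module `ι →₀ R` onto the degree-one part of its
symmetric algebra `MvPolynomial ι R`. -/
def symEmb (ι : Type*) : (ι →₀ R) →ₗ[R] MvPolynomial ι R :=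
  Finsupp.linearCombination R MvPolynomial.X

variable {R}

/-- The integral closure `U⁻_F` of a submodule `U` of the free module `F = ι →₀ R`:
the degree-one part of the integral closure, inside the symmetric algebra of `F`,
of the subalgebra generated by `U`. -/
def freeIC {ι : Type*} (U : Submodule R (ι →₀ R)) : Submodule R (ι →₀ R) where
  carrier := {x | IsIntegral (Algebra.adjoin R (symEmb R ι '' U)) (symEmb R ι x)}
  zero_mem' := by simpa using isIntegral_zero
  add_mem' := by
    intro a b ha hb
    simpa [map_add] using ha.add hb
  smul_mem' := by
    intro c x hx
    have hc : IsIntegral (Algebra.adjoin R (symEmb R ι '' ↑U))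
        ((algebraMap R (MvPolynomial ι R)) c) := by
      have : (algebraMap R (MvPolynomial ι R)) c
          = algebraMap (Algebra.adjoin R (symEmb R ι '' ↑U)) (MvPolynomial ι R)
            ⟨(algebraMap R (MvPolynomial ι R)) c,
              Subalgebra.algebraMap_mem _ c⟩ := rfl
      rw [this]
      exact isIntegral_algebraMap
    have : symEmb R ι (c • x) = (algebraMap R (MvPolynomial ι R)) c * symEmb R ι x := by
      rw [map_smul, Algebra.smul_def]
    simpa [Set.mem_setOf_eq, this] using hc.mul hx
  
/-- The liftable integral closure `lic(L, M)` of a submodule `L ⊆ M`, computed via the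
canonical free presentation `M →₀ R ↠ M`.  (By `LIC.lic_indep` this agrees with the
closure computed from any surjection of a free module onto `M`.) -/
def lic {M : Type*} [AddCommGroup M] [Module R M] (L : Submodule R M) : Submodule R M :=
  Submodule.map (Finsupp.linearCombination R (id : M → M))
    (freeIC (Submodule.comap (Finsupp.linearCombination R (id : M → M)) L))

end LIC

end

namespace LIC

open scoped TensorProduct

/-- A regular local ring: a Noetherian local ring whose maximal ideal can be generated by
`dim R` elements. -/
def IsRegularLocalRing (A : Type*) [CommRing A] : Prop :=
  IsNoetherianRing A ∧ ∃ _ : IsLocalRing A, ∃ s : Finset A,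
    Ideal.span (s : Set A) = IsLocalRing.maximalIdeal A ∧
    (s.card : WithBot ℕ∞) = ringKrullDim A

/-- A regular ring: all localizations at primes are regular local rings. -/
def IsRegularRing (A : Type*) [CommRing A] : Prop :=
  ∀ (q : Ideal A) (_ : q.IsPrime), IsRegularLocalRing (Localization.AtPrime q)

universe v

/-- An `R`-algebra `S` has geometrically regular fibers if for every prime `p ⊆ R` and
every finite field extension `K` of the residue field `κ(p) = Frac(R/p)`, the
base-changed fiber `K ⊗_R S` is a regular ring. -/
def HasGeometricallyRegularFibers (R : Type*) (S : Type*) [CommRing R] [CommRing S]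
    [Algebra R S] : Prop :=
  ∀ (p : Ideal R) (_ : p.IsPrime)
    (K : Type v) (_ : Field K) (_ : Algebra (R ⧸ p) K) (_ : NoZeroSMulDivisors (R ⧸ p) K)
    (_ : Algebra R K) (_ : IsScalarTower R (R ⧸ p) K),
    (letI := FractionRing.liftAlgebra (R ⧸ p) K
     FiniteDimensional (FractionRing (R ⧸ p)) K) →
    IsRegularRing (K ⊗[R] S)

/-- A catenary ring: any two saturated chains of primes with the same endpoints have the
same length. -/
def IsCatenaryRing (A : Type*) [CommRing A] : Prop :=
  ∀ c d : LTSeries (PrimeSpectrum A),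
    c.head = d.head → c.last = d.last →
    (∀ i : Fin c.length, c.toFun i.castSucc ⋖ c.toFun i.succ) →
    (∀ i : Fin d.length, d.toFun i.castSucc ⋖ d.toFun i.succ) →
    c.length = d.length

universe u

/-- A G-ring: for every prime `p`, the formal fibers of `R_p` (the fibers of the map from
`R_p` to its maximal-adic completion) are geometrically regular. -/
def IsGRing (R : Type u) [CommRing R] : Prop :=
  ∀ (p : Ideal R) (_ : p.IsPrime),
    HasGeometricallyRegularFibers.{u} (Localization.AtPrime p)
      (AdicCompletion (IsLocalRing.maximalIdeal (Localization.AtPrime p))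
        (Localization.AtPrime p))

/-- J-2: for every finite-type `R`-algebra, the regular locus of its prime spectrum is
open. -/
def IsJ2 (R : Type u) [CommRing R] : Prop :=
  ∀ (A : Type u) (_ : CommRing A) (_ : Algebra R A), Algebra.FiniteType R A →
    IsOpen {q : PrimeSpectrum A | IsRegularLocalRing (Localization.AtPrime q.asIdeal)}

/-- Universally catenary: every finite-type `R`-algebra is catenary. -/
def IsUniversallyCatenary (R : Type u) [CommRing R] : Prop :=
  ∀ (A : Type u) (_ : CommRing A) (_ : Algebra R A), Algebra.FiniteType R A →
    IsCatenaryRing A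

/-- An excellent ring: a universally catenary Noetherian G-ring satisfying J-2. -/
def IsExcellentRing (R : Type u) [CommRing R] : Prop :=
  IsNoetherianRing R ∧ IsUniversallyCatenary R ∧ IsGRing R ∧ IsJ2 R

open CategoryTheory in
/-- A Gorenstein local ring: a Noetherian local ring having finite injective dimension
over itself, i.e. admitting a finite-length injective resolution of itself. -/
def IsGorensteinLocalRing (S : Type u) [CommRing S] : Prop :=
  IsNoetherianRing S ∧ IsLocalRing S ∧
  ∃ (I : InjectiveResolution (ModuleCat.of S S)) (n : ℕ),
    ∀ m, n ≤ m → Limits.IsZero (I.cocomplex.X m)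

/-- A local ring is equidimensional if `dim (R/p) = dim R` for every minimal prime `p`. -/
def IsEquidimensionalRing (R : Type*) [CommRing R] : Prop :=
  ∀ p ∈ minimalPrimes R, ringKrullDim (R ⧸ p) = ringKrullDim R

/-- A ring has no embedded primes if every associated prime (of `R` as a module over
itself) is a minimal prime. -/
def HasNoEmbeddedPrimes (R : Type*) [CommRing R] : Prop :=
  ∀ p : Ideal R, IsAssociatedPrime p R → p ∈ minimalPrimes R

end LIC

universe u


section Helpers

open IsLocalRing


theorem LIC.compl_mem_iff {R : Type*} [CommRing R] (I : Ideal R) (hI : I.FG) (n : ℕ)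
    (a : AdicCompletion I R) :
    a ∈ (I ^ n).map (algebraMap R (AdicCompletion I R)) ↔ AdicCompletion.evalₐ I n a = 0 := by
  rw [← Submodule.restrictScalars_mem R, ← Ideal.smul_top_eq_map,
    AdicCompletion.pow_smul_top_eq_ker_eval hI, LinearMap.mem_ker]
  have h : I ^ n • ⊤ ≤ I ^ n := by simp
  have h' : I ^ n ≤ I ^ n • ⊤ := by simp
  constructor
  · intro e
    rw [← AdicCompletion.factor_eval_eq_evalₐ I a h, e, map_zero]
  · intro e
    rw [← AdicCompletion.factor_evalₐ_eq_eval I a h', e, map_zero]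

theorem LIC.compl_density {R : Type*} [CommRing R] (I : Ideal R) (hI : I.FG) (n : ℕ)
    (a : AdicCompletion I R) : ∃ r : R, a - algebraMap R _ r ∈
      (I ^ n).map (algebraMap R (AdicCompletion I R)) := by
  obtain ⟨r, hr⟩ := Ideal.Quotient.mk_surjective (AdicCompletion.evalₐ I n a)
  refine ⟨r, ?_⟩
  rw [LIC.compl_mem_iff I hI, map_sub, ← hr, AlgHom.commutes]
  simp

theorem LIC.compl_contract {R : Type*} [CommRing R] (I : Ideal R) (hI : I.FG) (n : ℕ)
    (a : R) (ha : algebraMap R (AdicCompletion I R) a ∈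
      (I ^ n).map (algebraMap R (AdicCompletion I R))) : a ∈ I ^ n := by
  rw [LIC.compl_mem_iff I hI, AlgHom.commutes] at ha
  exact Ideal.Quotient.eq_zero_iff_mem.mp ha

theorem LIC.compl_complete {R : Type*} [CommRing R] (I : Ideal R) (hI : I.FG)
    (r : ℕ → R) (h : ∀ k, r (k+1) - r k ∈ I ^ k) :
    ∃ a : AdicCompletion I R, ∀ k, a - algebraMap R _ (r k) ∈
      (I ^ k).map (algebraMap R (AdicCompletion I R)) := by
  let s : AdicCompletion.AdicCauchySequence I R := AdicCompletion.AdicCauchySequence.mk I R r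
    (fun k => by
      rw [SModEq.sub_mem, ← neg_sub]
      exact neg_mem (by simpa using h k))
  refine ⟨AdicCompletion.mk I R s, fun k => ?_⟩
  rw [LIC.compl_mem_iff I hI, map_sub, AlgHom.commutes, AdicCompletion.evalₐ_mk]
  simp [s]

theorem LIC.noeth_aux {P R : Type*} [CommRing P] [CommRing R] [IsLocalRing R] [IsNoetherianRing R]
    (J : Ideal P) (φ : P →+* R) (hφ : Function.Surjective φ) (hJfg : J.FG)
    (hN : IsNoetherianRing (AdicCompletion J P)) (hJ : J.map φ = maximalIdeal R) :
    IsNoetherianRing (AdicCompletion (maximalIdeal R) R) := by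
  have hle : ∀ n, J ^ n ≤ (maximalIdeal R ^ n).comap φ := fun n => by
    rw [← Ideal.map_le_iff_le_comap, Ideal.map_pow, hJ]
  let f : AdicCompletion J P →+* AdicCompletion (maximalIdeal R) R :=
    AdicCompletion.liftRingHom (maximalIdeal R)
      (fun n => (Ideal.quotientMap (maximalIdeal R ^ n) φ (hle n)).comp
        (AdicCompletion.evalₐ J n).toRingHom) (by
        intro m n h
        ext x
        obtain ⟨x, rfl⟩ := AdicCompletion.mk_surjective J P x
        have h2 : Ideal.Quotient.mk (J ^ m) (x n) = Ideal.Quotient.mk (J ^ m) (x m) := by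
          have := AdicCompletion.Ideal.mk_eq_mk J h x
          simpa using this
        have h3 : φ (x n) - φ (x m) ∈ maximalIdeal R ^ m := by
          rw [← map_sub]
          exact hle m (Ideal.Quotient.eq.mp h2)
        simpa using Ideal.Quotient.eq.mpr h3)
  have hf : f.comp (algebraMap P (AdicCompletion J P)) =
      (algebraMap R (AdicCompletion (maximalIdeal R) R)).comp φ := by
    refine RingHom.ext fun x => ?_
    apply AdicCompletion.ext_evalₐ
    intro n
    rw [RingHom.comp_apply, RingHom.comp_apply]
    simp only [f]
    rw [AdicCompletion.evalₐ_liftRingHom, AlgHom.commutes]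
    simp only [RingHom.comp_apply]
    have : (AdicCompletion.evalₐ J n).toRingHom ((algebraMap P (AdicCompletion J P)) x) = Ideal.Quotient.mk _ x :=
      AlgHom.commutes _ _
    rw [this]
    simp
  have hfJ : (J.map (algebraMap P (AdicCompletion J P))).map f = maximalIdeal _ := by
    have h1 : (maximalIdeal R).map (algebraMap R (AdicCompletion (maximalIdeal R) R)) =
      (J.map φ).map (algebraMap R (AdicCompletion (maximalIdeal R) R)) := by rw [hJ]
    rw [AdicCompletion.maximalIdeal_eq_map, h1, Ideal.map_map, Ideal.map_map, hf]
  have := AdicCompletion.isAdicComplete_self J hJfg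
  have h2 : IsHausdorff ((J.map (algebraMap P (AdicCompletion J P))).map f) (AdicCompletion (maximalIdeal R) R) := by
    rw [hfJ]; infer_instance
  have hsurj : Function.Surjective f := by
    apply surjective_of_mk_map_comp_surjective (I := J.map (algebraMap P (AdicCompletion J P))) f
    intro y
    obtain ⟨y, rfl⟩ := Ideal.Quotient.mk_surjective y
    obtain ⟨r, hr⟩ := LIC.compl_density (maximalIdeal R) (maximalIdeal R).fg_of_isNoetherianRing 1 y
    obtain ⟨p, rfl⟩ := hφ r
    refine ⟨algebraMap P _ p, ?_⟩
    rw [RingHom.comp_apply, ← RingHom.comp_apply f, hf, eq_comm, Ideal.Quotient.eq, hfJ,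
      AdicCompletion.maximalIdeal_eq_map]
    simpa using hr
  exact isNoetherianRing_of_surjective _ _ f hsurj

theorem LIC.noeth_completion (R : Type*) [CommRing R] [IsLocalRing R] [IsNoetherianRing R] :
    IsNoetherianRing (AdicCompletion (maximalIdeal R) R) := by
  obtain ⟨g, t, ht⟩ := Submodule.fg_iff_exists_fin_generating_family.mp
    (maximalIdeal R).fg_of_isNoetherianRing
  refine LIC.noeth_aux (P := MvPolynomial (Fin g) R) (MvPolynomial.idealOfVars (Fin g) R)
    (MvPolynomial.eval t) ?_ (Ideal.fg_of_isNoetherianRing _) ?_ ?_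
  · exact fun r => ⟨MvPolynomial.C r, by simp⟩
  · exact
    isNoetherianRing_of_ringEquiv _ (MvPowerSeries.toAdicCompletionAlgEquiv (Fin g) R).toRingEquiv
  · rw [← ht, MvPolynomial.idealOfVars, Ideal.map_span, Ideal.submodule_span_eq]
    congr 1
    ext x; simp


theorem LIC.regular_domain_aux (d : ℕ) : ∀ (L : Type u) [CommRing L] [IsLocalRing L]
    [IsNoetherianRing L] (s : Finset L), Ideal.span (s : Set L) = maximalIdeal L →
    s.card = d → (s.card : WithBot ℕ∞) = ringKrullDim L → IsDomain L := by
  induction d with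
  | zero =>
    intro L _ _ _ s hs hc hd
    have : s = ∅ := by simpa using hc
    subst this
    have h0 : maximalIdeal L = ⊥ := by rw [← hs]; simp
    exact (IsLocalRing.isField_iff_maximalIdeal_eq.mpr h0).isDomain
  | succ d ih =>
    intro L _ _ _ s hs hc hd
    classical
    have hn1 : ¬ maximalIdeal L ≤ maximalIdeal L ^ 2 := by
      intro h
      have h0 : maximalIdeal L = ⊥ := by
        refine Submodule.eq_bot_of_le_smul_of_le_jacobson_bot (maximalIdeal L) _
          (Ideal.fg_of_isNoetherianRing _) ?_ ?_
        · simpa [pow_two] using h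
        · exact IsLocalRing.maximalIdeal_le_jacobson _
      have := ringKrullDim_eq_zero_of_isField (IsLocalRing.isField_iff_maximalIdeal_eq.mpr h0)
      rw [← hd, hc] at this
      exact absurd this (by norm_cast)
    have hn2 : ∀ p ∈ minimalPrimes L, ¬ maximalIdeal L ≤ p := by
      intro p hp h
      have hpe : p = maximalIdeal L :=
        le_antisymm (IsLocalRing.le_maximalIdeal hp.1.1.ne_top) h
      have hh : (maximalIdeal L).height = 0 := by
        rw [Ideal.height_eq_zero_iff]
        rwa [← hpe]
      have := IsLocalRing.maximalIdeal_height_eq_ringKrullDim (R := L)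
      rw [hh, ← hd, hc] at this
      exact absurd this (by norm_cast)
    obtain ⟨x, hxn, hx2, hxp⟩ : ∃ x ∈ maximalIdeal L, x ∉ maximalIdeal L ^ 2 ∧
        ∀ p ∈ minimalPrimes L, x ∉ p := by
      by_contra! hcon
      have hfin : (insert (maximalIdeal L ^ 2) (minimalPrimes L)).Finite :=
        (minimalPrimes.finite_of_isNoetherianRing L).insert _
      have := (Ideal.subset_union_prime_finite hfin (f := id) (maximalIdeal L ^ 2)
        (maximalIdeal L ^ 2) (I := maximalIdeal L) (by
          intro i hi h1 _
          rcases hi with hi | hi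
          · exact absurd hi h1
          · exact hi.1.1)).1 (by
          intro x hx
          by_cases h2 : x ∈ maximalIdeal L ^ 2
          · simp only [Set.mem_iUnion]
            exact ⟨_, Set.mem_insert _ _, h2⟩
          · obtain ⟨p, hp, hxp⟩ := hcon x hx h2
            simp only [Set.mem_iUnion]
            exact ⟨p, Set.mem_insert_of_mem _ hp, hxp⟩)
      obtain ⟨p, hp | hp, hle⟩ := this
      · subst hp; exact hn1 hle
      · exact hn2 p hp hle
    -- the quotient
    let Q := L ⧸ Ideal.span {x}
    have hxne : Ideal.span {x} ≠ ⊤ := by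
      rw [Ne, Ideal.span_singleton_eq_top]
      exact fun h => (IsLocalRing.mem_maximalIdeal x).mp hxn h
    have : Nontrivial Q := Ideal.Quotient.nontrivial_iff.mpr hxne
    have : IsLocalRing Q := IsLocalRing.of_surjective' _ (Ideal.Quotient.mk_surjective (I := Ideal.span {x}))
    have hmapmax : (maximalIdeal L).map (Ideal.Quotient.mk (Ideal.span {x})) = maximalIdeal Q := by
      refine IsLocalRing.eq_maximalIdeal ?_
      refine Ideal.IsMaximal.map_of_surjective_of_ker_le Ideal.Quotient.mk_surjective ?_
      simpa [Ideal.span_le] using hxn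
    obtain ⟨i0, hi0, t, ht⟩ : ∃ i0 ∈ s, ∃ t : Finset Q, t = (s.erase i0).image (Ideal.Quotient.mk (Ideal.span {x})) ∧
        Ideal.Quotient.mk (Ideal.span {x}) i0 ∈ Ideal.span (t : Set Q) := by
      have hxs : x ∈ Submodule.span L (s : Set L) := by
        change x ∈ Ideal.span _; rw [hs]; exact hxn
      obtain ⟨a, -, ha⟩ := Submodule.mem_span_finset.mp hxs
      obtain ⟨i0, hi0, hu⟩ : ∃ i0 ∈ s, IsUnit (a i0) := by
        by_contra! hcon
        apply hx2
        rw [← ha, pow_two]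
        refine Ideal.sum_mem _ fun i hi => Ideal.mul_mem_mul ?_ ?_
        · exact (IsLocalRing.mem_maximalIdeal _).mpr (hcon i hi)
        · rw [← hs]; exact Ideal.subset_span hi
      refine ⟨i0, hi0, _, rfl, ?_⟩
      have h1 : a i0 * i0 = x - ∑ i ∈ s.erase i0, a i * i := by
        rw [← ha, ← Finset.add_sum_erase s _ hi0]
        simp
      rw [← Ideal.unit_mul_mem_iff_mem _ (hu.map (Ideal.Quotient.mk (Ideal.span {x}))), ← map_mul, h1, map_sub]
      have : Ideal.Quotient.mk (Ideal.span {x}) x = 0 :=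
        Ideal.Quotient.eq_zero_iff_mem.mpr (Ideal.mem_span_singleton_self x)
      rw [this, zero_sub, neg_mem_iff, map_sum]
      refine Ideal.sum_mem _ fun i hi => ?_
      rw [map_mul]
      refine Ideal.mul_mem_left _ _ (Ideal.subset_span ?_)
      simp only [Finset.coe_image]
      exact ⟨i, hi, rfl⟩
    have htspan : Ideal.span (t : Set Q) = maximalIdeal Q := by
      rw [← hmapmax, ← hs, Ideal.map_span]
      apply le_antisymm
      · apply Ideal.span_mono
        rw [ht.1, Finset.coe_image]
        exact Set.image_mono (by simp)
      · rw [Ideal.span_le]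
        rintro _ ⟨i, hi, rfl⟩
        by_cases h : i = i0
        · rw [h]; exact ht.2
        · apply Ideal.subset_span
          rw [ht.1, Finset.coe_image]
          exact ⟨i, by simpa using ⟨hi, h⟩, rfl⟩
    have hcard : t.card ≤ d := by
      rw [ht.1]
      refine Finset.card_image_le.trans ?_
      rw [Finset.card_erase_of_mem hi0, hc]; simp
    have hdim1 : ringKrullDim Q ≤ t.card := by
      rw [← IsLocalRing.maximalIdeal_height_eq_ringKrullDim]
      have : (maximalIdeal Q).height ≤ t.card := by
        apply Ideal.height_le_card_of_mem_minimalPrimes_span_finset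
        rw [htspan, Ideal.minimalPrimes_eq_subsingleton_self]
        rfl
      exact_mod_cast this
    have hdim2 : ringKrullDim L ≤ ringKrullDim Q + 1 := by
      have := ringKrullDim_le_ringKrullDim_quotient_add_card (R := L) {x} (by
        rw [IsLocalRing.ringJacobson_eq_maximalIdeal]; simpa using hxn)
      rw [Finset.coe_singleton] at this
      simpa using this
    rw [← hd, hc] at hdim2
    have hdim3 : (d : WithBot ℕ∞) ≤ ringKrullDim Q := by
      have h5 : ((d:WithBot ℕ∞) + 1) ≤ ringKrullDim Q + 1 := by exact_mod_cast hdim2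
      by_contra! hlt
      have h6 := h5.trans (ENat.WithBot.add_one_le_natCast_iff.mpr hlt)
      have h7 : d + 1 ≤ d := by exact_mod_cast h6
      omega 
    have hcd : t.card = d := le_antisymm hcard (by exact_mod_cast hdim3.trans hdim1)
    have hdomQ : IsDomain Q := ih Q t htspan hcd (le_antisymm (by rw [hcd]; exact hdim3) hdim1)
    have hprime : (Ideal.span {x}).IsPrime := Ideal.Quotient.isDomain_iff_prime _ |>.mp hdomQ
    obtain ⟨g, hg, hgx⟩ := Ideal.exists_minimalPrimes_le (I := (⊥ : Ideal L)) (J := Ideal.span {x}) bot_le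
    have hg' : g ∈ minimalPrimes L := hg
    have hxg := hxp g hg'
    have hgp := hg.1.1
    have : g = ⊥ := by
      refine Submodule.eq_bot_of_le_smul_of_le_jacobson_bot (Ideal.span {x}) _
          (Ideal.fg_of_isNoetherianRing _) ?_ ?_
      · intro z hz
        obtain ⟨w, rfl⟩ := Ideal.mem_span_singleton'.mp (hgx hz)
        rcases hgp.mem_or_mem hz with h | h
        · rw [mul_comm]
          exact Submodule.smul_mem_smul (Ideal.mem_span_singleton_self x) h
        · exact absurd h hxg
      · exact (IsLocalRing.le_maximalIdeal hxne).trans (IsLocalRing.maximalIdeal_le_jacobson _)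
    subst this
    exact IsDomain.of_bot_isPrime L


theorem LIC.flat_colon {D B : Type*} [CommRing D] [IsNoetherianRing D] [CommRing B] [Algebra D B]
    [Module.Flat D B] (I : Ideal D) (c : D) (v : B)
    (h : ∀ w ∈ I, ∃ β : B, algebraMap D B w * v = algebraMap D B c * β) :
    ∃ (k : ℕ) (d : Fin k → D) (y : Fin k → B), v = ∑ j, algebraMap D B (d j) * y j ∧
      ∀ w ∈ I, ∀ j, ∃ e, w * d j = c * e := by
  classical
  obtain ⟨n, w, hw⟩ := Submodule.fg_iff_exists_fin_generating_family.mp I.fg_of_isNoetherianRing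
  have hwI : ∀ i, w i ∈ I := fun i => by rw [← hw]; exact Submodule.subset_span ⟨i, rfl⟩
  choose β hβ using fun i => h (w i) (hwI i)
  let f : (Fin n → D) →ₗ[D] D × (Fin n → D) :=
    LinearMap.prod (Fintype.linearCombination D w) (c • LinearMap.id)
  let x : D × (Fin n → D) →ₗ[D] B :=
    LinearMap.coprod (LinearMap.toSpanSingleton D B v) (- Fintype.linearCombination D β)
  have hxf : x ∘ₗ f = 0 := by
    refine LinearMap.pi_ext' fun i => LinearMap.ext_ring ?_
    simp [x, f, Fintype.linearCombination_apply, Pi.single_apply, Algebra.smul_def, hβ, apply_ite (algebraMap D B), ite_mul]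
  obtain ⟨k, a, y, hxy, haf⟩ := Module.Flat.exists_factorization_of_comp_eq_zero_of_free hxf
  refine ⟨k, fun j => a (1, 0) j, fun j => y (Finsupp.single j 1), ?_, ?_⟩
  · have h1 : v = x (1, 0) := by simp [x]
    rw [h1, hxy, LinearMap.comp_apply]
    conv_lhs => rw [← Finsupp.univ_sum_single (a (1,0)), map_sum]
    refine Finset.sum_congr rfl fun j _ => ?_
    rw [← Algebra.smul_def, ← map_smul, Finsupp.smul_single, smul_eq_mul, mul_one]
  · intro z hz j
    rw [← hw] at hz
    induction hz using Submodule.span_induction with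
    | mem z hz =>
      obtain ⟨i, rfl⟩ := hz
      have h1 := DFunLike.congr_fun (LinearMap.congr_fun haf (Pi.single i 1)) j
      have h2 : f (Pi.single i 1) = w i • (1, 0) + c • (0, Pi.single i 1) := by
        simp [f, Fintype.linearCombination_apply, Pi.single_apply]
      rw [LinearMap.comp_apply, h2, map_add, map_smul, map_smul] at h1
      simp only [Finsupp.add_apply, Finsupp.smul_apply, smul_eq_mul, LinearMap.zero_apply, Finsupp.zero_apply] at h1
      exact ⟨- a (0, Pi.single i 1) j, by linear_combination h1⟩
    | zero => exact ⟨0, by simp⟩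
    | add p q _ _ hp hq =>
      obtain ⟨e, he⟩ := hp
      obtain ⟨e', he'⟩ := hq
      exact ⟨e + e', by linear_combination he + he'⟩
    | smul r p _ hp =>
      obtain ⟨e, he⟩ := hp
      exact ⟨r * e, by rw [smul_eq_mul]; linear_combination r * he⟩

/-- approximation of the `idempotent-like` element. -/
theorem LIC.approx {D B : Type*} [CommRing D] [IsNoetherianRing D] [CommRing B] [Algebra D B]
    [Module.Flat D B] (m : Ideal D) (t : ℕ) (c : D) (v : B)
    (hden : ∀ (k : ℕ) (β : B), ∃ d : D, β - algebraMap D B d ∈ (m ^ k).map (algebraMap D B))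
    (h : ∀ w ∈ m ^ t, ∃ β : B, algebraMap D B w * v = algebraMap D B c * β) :
    ∃ (b : D) (ε : B), ε ∈ m.map (algebraMap D B) ∧
      v = algebraMap D B b + algebraMap D B c * ε := by
  obtain ⟨k, d, y, hv, hd⟩ := LIC.flat_colon (m ^ t) c v h
  choose y' hy' using fun j => hden (t + 1) (y j)
  have key : ∀ j, ∃ ε ∈ m.map (algebraMap D B), algebraMap D B (d j) * (y j - algebraMap D B (y' j))
      = algebraMap D B c * ε := by
    intro j
    have : (m ^ (t+1)).map (algebraMap D B) ≤ Submodule.comap (LinearMap.mulLeft B (algebraMap D B (d j)))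
        (Submodule.map (LinearMap.mulLeft B (algebraMap D B c)) (m.map (algebraMap D B))) := by
      rw [Ideal.map_le_iff_le_comap, pow_succ]
      intro z hz
      induction hz using Submodule.mul_induction_on' with
      | mem_mul_mem w hw μ hμ =>
        obtain ⟨e, he⟩ := hd w hw j
        rw [Ideal.mem_comap]
        refine ⟨algebraMap D B (e * μ), Ideal.mem_map_of_mem _ (m.mul_mem_left _ hμ), ?_⟩
        simp only [LinearMap.mulLeft_apply, ← map_mul]
        congr 1
        linear_combination - μ * he
      | add p _ q _ hp hq => exact Ideal.add_mem _ hp hq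
    obtain ⟨ε, h1, h2⟩ := this (hy' j)
    exact ⟨ε, h1, h2.symm⟩
  choose ε hε hεe using key
  refine ⟨∑ j, d j * y' j, ∑ j, ε j, Ideal.sum_mem _ fun j _ => hε j, ?_⟩
  rw [hv, map_sum, Finset.mul_sum, ← Finset.sum_add_distrib]
  refine Finset.sum_congr rfl fun j _ => ?_
  rw [← hεe, map_mul]; ring

theorem LIC.poly_div {D : Type*} [CommRing D] (b c : D) (f : Polynomial D) :
    ∃ (N : ℕ) (q : Polynomial D) (r : D), Polynomial.C (c ^ N) * f =
      (Polynomial.C c * Polynomial.X - Polynomial.C b) * q + Polynomial.C r := by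
  open Polynomial in
  induction f using Polynomial.induction_on' with
  | add f g hf hg =>
    obtain ⟨N, q, r, h⟩ := hf
    obtain ⟨N', q', r', h'⟩ := hg
    refine ⟨N + N', C (c ^ N') * q + C (c ^ N) * q', c ^ N' * r + c ^ N * r', ?_⟩
    simp only [pow_add, C_add, C_mul]
    linear_combination C (c ^ N') * h + C (c ^ N) * h'
  | monomial n a =>
    induction n with
    | zero => exact ⟨0, 0, a, by simp⟩
    | succ n ih =>
      obtain ⟨N, q, r, h⟩ := ih
      refine ⟨N + 1, C c * X * q + C r, b * r, ?_⟩
      rw [← Polynomial.monomial_mul_X]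
      simp only [pow_succ, C_mul]
      linear_combination C c * X * h


theorem LIC.catenary_contra {A : Type*} [CommRing A] [IsNoetherianRing A] (hA : LIC.IsCatenaryRing A)
    (p0 q n a b : PrimeSpectrum A) (h1 : p0 ⋖ q) (h2 : q ⋖ n) (h3 : p0 < a) (h4 : a < b)
    (h5 : b < n) : False := by
  have w1 : WellFoundedLT (PrimeSpectrum A) := by
    have : StrictMono (fun p : PrimeSpectrum A => p.asIdeal.height) := fun p q h =>
      Ideal.height_strict_mono_of_isPrime (I := p.asIdeal) (J := q.asIdeal) h
    exact this.wellFoundedLT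
  have w2 : WellFoundedGT (PrimeSpectrum A) := by
    have : StrictMono (fun p : PrimeSpectrum A => p.asIdeal) := fun p q h => h
    exact this.wellFoundedGT
  let s : LTSeries (PrimeSpectrum A) := ⟨3, ![p0, a, b, n], by
    intro i
    fin_cases i
    · exact h3
    · exact h4
    · exact h5⟩
  obtain ⟨t, i, hti, hi0, hil⟩ := s.exists_relSeries_covBy
  let t' : LTSeries (PrimeSpectrum A) := ⟨t.length, t.toFun, fun i => (t.step i).lt⟩
  let c : LTSeries (PrimeSpectrum A) := ⟨2, ![p0, q, n], by
    intro i
    fin_cases i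
    · exact h1.lt
    · exact h2.lt⟩
  have hs : s.length = 3 := rfl
  have hc : c.length = 2 := rfl
  have hle : s.length ≤ t'.length := by simpa using Fintype.card_le_of_embedding i
  have := hA c t' (by
      have e1 : t'.head = s.head := by
        change t.toFun 0 = s.toFun 0
        rw [← hi0, ← hti]; rfl
      rw [e1]; rfl) (by
      have e1 : t'.last = s.last := by
        change t.toFun (Fin.last _) = s.toFun (Fin.last _)
        rw [← hil, ← hti]; rfl
      rw [e1]; rfl) (by
      intro i
      change Fin 2 at i
      fin_cases i
      · exact h1
      · exact h2) (fun i => t.step i)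
  omega

open Polynomial in
theorem LIC.ratliff {D B : Type*} [CommRing D] [IsDomain D] [IsLocalRing D] [IsNoetherianRing D]
    [CommRing B] [Algebra D B] [Module.Flat D B]
    (hden : ∀ (k : ℕ) (β : B), ∃ d : D, β - algebraMap D B d ∈
      (maximalIdeal D ^ k).map (algebraMap D B))
    (hcon : ∀ (I : Ideal D) (x : D), algebraMap D B x ∈ I.map (algebraMap D B) → x ∈ I)
    (P' : Ideal B) (hPp : P'.IsPrime) (hPm : P' ≤ (maximalIdeal D).map (algebraMap D B))
    (hP0 : ∀ d, algebraMap D B d ∈ P' → d = 0)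
    (s : B) (hsP : ∀ u ∈ P', s * u = 0) (t : ℕ)
    (ht : (maximalIdeal D ^ t).map (algebraMap D B) ≤ P' ⊔ Ideal.span {s})
    (hg : ∀ g : D, g ≠ 0 → ∃ τ : ℕ, (maximalIdeal D ^ τ).map (algebraMap D B) ≤
      P' ⊔ Ideal.span {algebraMap D B g})
    (g1 : Ideal D) (hg1 : g1.IsPrime) (hg1b : g1 ≠ ⊥) (hg1m : g1 ≠ maximalIdeal D)
    (hcat : LIC.IsCatenaryRing D[X]) : False := by
  set m := maximalIdeal D with hm
  set α := algebraMap D B with hα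
  have hg1le : g1 ≤ m := IsLocalRing.le_maximalIdeal hg1.ne_top
  obtain ⟨x0, hx0, hx0n⟩ := Submodule.exists_mem_ne_zero_of_ne_bot hg1b
  -- decomposition of elements of m^t
  have hdec : ∀ w ∈ m ^ t, ∃ u ∈ P', ∃ v : B, α w = u + v * s := by
    intro w hw
    have := ht (Ideal.mem_map_of_mem α hw)
    obtain ⟨u, hu, v, hv, h⟩ := Submodule.mem_sup.mp this
    obtain ⟨v', rfl⟩ := Ideal.mem_span_singleton'.mp hv
    exact ⟨u, hu, v', h.symm⟩
  obtain ⟨c, hc, hcn⟩ : ∃ c ∈ m ^ t, c ≠ 0 :=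
    ⟨x0 ^ t, Ideal.pow_mem_pow (hg1le hx0) t, pow_ne_zero _ hx0n⟩
  obtain ⟨u, hu, v1, huv⟩ := hdec c hc
  obtain ⟨v, hv⟩ : ∃ v, v = v1 * s := ⟨_, rfl⟩
  rw [← hv] at huv
  have huP : ∀ z ∈ P', v * z = 0 := fun z hz => by
    rw [hv, mul_assoc, hsP z hz, mul_zero]
  have hv2 : v * v = α c * v := by
    rw [huv]; linear_combination - huP u hu
  have hwv : ∀ w ∈ m ^ t, ∃ β : B, α w * v = α c * β := by
    intro w hw
    obtain ⟨u', hu', v', h'⟩ := hdec w hw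
    refine ⟨v' * s, ?_⟩
    rw [h', huv]
    have h1 := huP u' hu'
    have h2 := hsP u hu
    linear_combination h1 - v' * h2
  obtain ⟨b, ε, hε, hvb⟩ := LIC.approx m t c v hden hwv
  have hcreg : ∀ z : B, α c * z = 0 → z = 0 := by
    intro z hz
    have h1 : IsSMulRegular B c := Module.Flat.isSMulRegular_of_nonZeroDivisors
      (mem_nonZeroDivisors_of_ne_zero hcn)
    apply h1
    simp only [Algebra.smul_def, mul_zero]
    exact hz
  -- the quadratic equation
  obtain ⟨a1, ha1, a2, ha2, hquad⟩ : ∃ a1 ∈ m, ∃ a2 ∈ m,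
      b * b - b * c = a1 * (c * b) + a2 * (c * c) := by
    have h1 : b * b - b * c ∈ m * Ideal.span {c * b, c * c} := by
      apply hcon
      have e : α (b * b - b * c) = (- 2 * ε) * α (c * b) + (ε - ε * ε) * α (c * c) := by
        simp only [map_sub, map_mul]
        rw [hvb] at hv2
        linear_combination hv2
      rw [e, Ideal.map_mul]
      refine Ideal.add_mem _ (Ideal.mul_mem_mul (Ideal.mul_mem_left _ _ hε) ?_)
        (Ideal.mul_mem_mul (Ideal.sub_mem _ hε (Ideal.mul_mem_left _ _ hε)) ?_)
      · exact Ideal.mem_map_of_mem _ (Ideal.subset_span (by simp))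
      · exact Ideal.mem_map_of_mem _ (Ideal.subset_span (by simp))
    rw [Ideal.span_insert, Ideal.mul_sup] at h1
    obtain ⟨p, hp, q, hq, hpq⟩ := Submodule.mem_sup.mp h1
    obtain ⟨a1, ha1, rfl⟩ := Ideal.mem_mul_span_singleton.mp hp
    obtain ⟨a2, ha2, rfl⟩ := Ideal.mem_mul_span_singleton.mp hq
    exact ⟨a1, ha1, a2, ha2, hpq.symm⟩
  -- the prime q
  let K := FractionRing D
  let h : K := algebraMap D K b / algebraMap D K c
  have hcK : algebraMap D K c ≠ 0 := by
    simpa using hcn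
  have hch : algebraMap D K c * h = algebraMap D K b := mul_div_cancel₀ _ hcK
  let ev : D[X] →+* K := (aeval h : D[X] →ₐ[D] K).toRingHom
  let 𝔮 : Ideal D[X] := RingHom.ker ev
  have hqp : 𝔮.IsPrime := RingHom.ker_isPrime ev
  have hevC : ∀ r : D, ev (C r) = algebraMap D K r := fun r => by simp [ev]
  have hevX : ev X = h := by simp [ev]
  have hqC : ∀ r : D, C r ∈ 𝔮 → r = 0 := by
    intro r hr
    have : ev (C r) = 0 := hr
    rw [hevC] at this
    simpa using this
  have hlin : C c * X - C b ∈ 𝔮 := by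
    change ev _ = 0
    rw [map_sub, map_mul, hevC, hevC, hevX]
    rw [hch, sub_self]
  have hqdiv : ∀ f ∈ 𝔮, ∃ (N : ℕ) (q : D[X]), C (c ^ N) * f = (C c * X - C b) * q := by
    intro f hf
    obtain ⟨N, q, r, he⟩ := LIC.poly_div b c f
    have : C r ∈ 𝔮 := by
      have : C r = C (c ^ N) * f - (C c * X - C b) * q := by rw [he]; ring
      rw [this]
      exact 𝔮.sub_mem (𝔮.mul_mem_left _ hf) (𝔮.mul_mem_right _ hlin)
    rw [hqC r this] at he
    exact ⟨N, q, by simpa using he⟩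
  have hquadq : X * X - X - C a1 * X - C a2 ∈ 𝔮 := by
    change ev _ = 0
    simp only [map_sub, map_mul, hevC, hevX]
    have := congrArg (algebraMap D K) hquad
    simp only [map_sub, map_mul, map_add] at this
    have h2 : (algebraMap D K c) ^ 2 * (h * h - h - algebraMap D K a1 * h - algebraMap D K a2) = 0 := by
      rw [← hch] at this
      linear_combination this
    exact (mul_eq_zero.mp h2).resolve_left (pow_ne_zero 2 hcK)
  -- n1
  let n1 : Ideal D[X] := m.comap (evalRingHom 1)
  have hn1p : n1.IsPrime := Ideal.comap_isPrime _ _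
  have hn1 : ∀ f : D[X], f ∈ n1 ↔ f.eval 1 ∈ m := fun f => Iff.rfl
  have hqn1 : 𝔮 ≤ n1 := by
    intro f hf
    obtain ⟨N, q, he⟩ := hqdiv f hf
    have e1 := congrArg (aeval (1 - ε)) he
    simp only [map_mul, map_sub, aeval_C, aeval_X] at e1
    have h1 : aeval (1 - ε) f ∈ P' := by
      have h2 : α (c ^ N) * aeval (1 - ε) f ∈ P' := by
        rw [e1]
        refine P'.mul_mem_right _ ?_
        have : α c * (1 - ε) - α b = u := by
          rw [mul_sub, mul_one]
          linear_combination huv + hvb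
        rw [← hα, this]; exact hu
      refine (hPp.mem_or_mem h2).resolve_left fun h3 => ?_
      exact pow_ne_zero N hcn (hP0 _ h3)
    rw [hn1]
    apply hcon
    have h3 : aeval (1 - ε) f - α (f.eval 1) ∈ m.map α := by
      have h4 : (1 - ε) - 1 ∣ (f.map α).eval (1 - ε) - (f.map α).eval 1 := sub_dvd_eval_sub _ _ _
      have e2 : (f.map α).eval (1 - ε) = aeval (1 - ε) f := by
        rw [eval_map_algebraMap]
      have e3 : (f.map α).eval 1 = α (f.eval 1) := by
        rw [← Polynomial.eval₂_at_one, eval_map]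
      rw [e2, e3] at h4
      obtain ⟨z, hz⟩ := h4
      rw [hz]
      refine Ideal.mul_mem_right _ _ ?_
      simpa using hε
    have := (m.map α).sub_mem (hPm h1) h3
    simpa using this
  -- bot covered by q
  have hcq : ∀ N, C (c ^ N) ∉ 𝔮 := fun N hN => pow_ne_zero N hcn (hqC _ hN)
  have hqmin : 𝔮 ∈ (Ideal.span {C c * X - C b}).minimalPrimes := by
    refine ⟨⟨hqp, by rw [Ideal.span_le]; simpa using hlin⟩, ?_⟩
    rintro G ⟨hGp, hGle⟩ hGq f hf
    obtain ⟨N, q, he⟩ := hqdiv f hf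
    have : C (c ^ N) * f ∈ G := by
      rw [he]; exact G.mul_mem_right _ (hGle (Ideal.mem_span_singleton_self _))
    exact (hGp.mem_or_mem this).resolve_left fun h3 => hcq N (hGq h3)
  have hqh : 𝔮.height ≤ 1 := Ideal.height_le_one_of_isPrincipal_of_mem_minimalPrimes _ _ hqmin
  have hlinne : C c * X - C b ≠ 0 := by
    intro h0
    have := congrArg (fun f => coeff f 1) h0
    simp [coeff_C] at this
    exact hcn this
  have hq0 : 𝔮 ≠ ⊥ := fun h0 => hlinne (by rw [h0] at hlin; simpa using hlin)
  have hcov1 : ∀ G : Ideal D[X], G.IsPrime → G < 𝔮 → G = ⊥ := by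
    intro G hG hlt
    have h1 := (Ideal.height_strict_mono_of_isPrime hlt).trans_le hqh
    have h2 : G.height = 0 := by
      simpa using h1
    exact Ideal.height_eq_zero_iff_eq_bot.mp h2
  -- q covered by n1
  have hcov2 : ∀ G : Ideal D[X], G.IsPrime → 𝔮 < G → G ≤ n1 → G = n1 := by
    intro G hG hqG hGn
    obtain ⟨g, hgG, hgn⟩ : ∃ g : D, C g ∈ G ∧ g ≠ 0 := by
      by_contra! hcon'
      apply hqG.not_ge
      intro f hf
      obtain ⟨N, q, r, he⟩ := LIC.poly_div b c f
      have : C r ∈ G := by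
        have : C r = C (c ^ N) * f - (C c * X - C b) * q := by rw [he]; ring
        rw [this]
        exact G.sub_mem (G.mul_mem_left _ hf) (G.mul_mem_right _ (hqG.le hlin))
      rw [hcon' r this] at he
      have h1 : C (c ^ N) * f ∈ 𝔮 := by
        rw [he]; simpa using 𝔮.mul_mem_right _ hlin
      exact (hqp.mem_or_mem h1).resolve_left (hcq N)
    obtain ⟨τ, hτ⟩ := hg g hgn
    have hcX : C c * X - C b ∈ G := hqG.le hlin
    -- w X - μ ∈ G
    have hwX : ∀ w ∈ m ^ τ, ∃ μ ∈ m ^ (τ + 1), C w * X - C μ ∈ G := by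
      intro w hw
      obtain ⟨π, hπ, y, hy, hwe⟩ := Submodule.mem_sup.mp (hτ (Ideal.mem_map_of_mem α hw))
      obtain ⟨β, rfl⟩ := Ideal.mem_span_singleton'.mp hy
      have h1 : w * b ∈ Ideal.span {g * b} ⊔ Ideal.span {g * c} ⊔ m ^ (τ + 1) * Ideal.span {c} := by
        apply hcon
        have h2 : α w * v = α g * β * v := by
          rw [← hwe]; linear_combination huP π hπ
        have e : α (w * b) = β * α (g * b) + (β * ε) * α (g * c) - (α w * ε) * α c := by
          simp only [map_mul]
          rw [hvb] at h2
          linear_combination h2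
        rw [e, Ideal.map_sup, Ideal.map_sup, Ideal.map_mul]
        refine Ideal.sub_mem _ (Ideal.add_mem _ ?_ ?_) ?_
        · refine Ideal.mem_sup_left (Ideal.mem_sup_left (Ideal.mul_mem_left _ _ ?_))
          exact Ideal.mem_map_of_mem _ (Ideal.mem_span_singleton_self _)
        · refine Ideal.mem_sup_left (Ideal.mem_sup_right (Ideal.mul_mem_left _ _ ?_))
          exact Ideal.mem_map_of_mem _ (Ideal.mem_span_singleton_self _)
        · refine Ideal.mem_sup_right (Ideal.mul_mem_mul ?_ ?_)
          · rw [pow_succ, Ideal.map_mul]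
            exact Ideal.mul_mem_mul (Ideal.mem_map_of_mem _ hw) hε
          · exact Ideal.mem_map_of_mem _ (Ideal.mem_span_singleton_self _)
      obtain ⟨p12, hp12, p3, hp3, hpe⟩ := Submodule.mem_sup.mp h1
      obtain ⟨p1, hp1, p2, hp2, rfl⟩ := Submodule.mem_sup.mp hp12
      obtain ⟨d1, rfl⟩ := Ideal.mem_span_singleton'.mp hp1
      obtain ⟨d2, rfl⟩ := Ideal.mem_span_singleton'.mp hp2
      obtain ⟨μ, hμ, rfl⟩ := Ideal.mem_mul_span_singleton.mp hp3
      refine ⟨μ, hμ, ?_⟩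
      have h3 : C w * X - C μ - C g * (C d1 * X + C d2) ∈ 𝔮 := by
        change ev _ = 0
        simp only [map_sub, map_mul, map_add, hevC, hevX]
        have e2 := congrArg (algebraMap D K) hpe
        simp only [map_mul, map_add] at e2
        rw [← hch] at e2
        have e3 : algebraMap D K c * (algebraMap D K w * h - algebraMap D K μ -
            algebraMap D K g * (algebraMap D K d1 * h + algebraMap D K d2)) = 0 := by
          linear_combination - e2
        exact (mul_eq_zero.mp e3).resolve_left hcK
      have h4 := G.add_mem (hqG.le h3) (G.mul_mem_right (C d1 * X + C d2) hgG)
      simpa using h4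
    have hXn1 : (X : D[X]) - 1 ∈ n1 := by rw [hn1]; simp
    have hmn1 : m.map C ≤ n1 := by
      rw [Ideal.map_le_iff_le_comap]
      intro w hw
      change C w ∈ n1
      rw [hn1]; simpa using hw
    have hN : (m ^ τ).map C ≤ G ⊔ n1 • (m ^ τ).map (C : D →+* D[X]) := by
      rw [Ideal.map_le_iff_le_comap]
      intro w hw
      change C w ∈ G ⊔ n1 • (m ^ τ).map (C : D →+* D[X])
      obtain ⟨μ, hμ, hwμ⟩ := hwX w hw
      have e : C w = (C w * X - C μ) + (C μ - (X - 1) * C w) := by ring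
      rw [e]
      refine Ideal.add_mem _ (Ideal.mem_sup_left hwμ) (Ideal.mem_sup_right ?_)
      refine Submodule.sub_mem _ ?_ (Ideal.mul_mem_mul hXn1 (Ideal.mem_map_of_mem _ hw))
      have h5 : C μ ∈ (m ^ (τ + 1)).map (C : D →+* D[X]) := Ideal.mem_map_of_mem _ hμ
      rw [pow_succ', Ideal.map_mul] at h5
      exact Ideal.mul_mono_left hmn1 h5
    have hNG : (m ^ τ).map C ≤ G := by
      have hfg : ((m ^ τ).map (C : D →+* D[X])).FG := Ideal.fg_of_isNoetherianRing _
      obtain ⟨r, hr, hrN⟩ := Submodule.exists_sub_one_mem_and_smul_le_of_fg_of_le_sup hfg le_rfl hN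
      intro z hz
      have h5 : r * z ∈ G := hrN (Submodule.smul_mem_pointwise_smul _ _ _ hz)
      refine (hG.mem_or_mem h5).resolve_left fun h6 => ?_
      have h7 := n1.sub_mem (hGn h6) hr
      rw [sub_sub_cancel] at h7
      exact (Ideal.ne_top_iff_one _).mp hn1p.ne_top h7
    have hmG : ∀ w ∈ m, C w ∈ G := by
      intro w hw
      have := hNG (Ideal.mem_map_of_mem C (Ideal.pow_mem_pow hw τ))
      rw [C_pow] at this
      exact hG.mem_of_pow_mem _ this
    have hX1 : X - 1 ∈ G := by
      have h5 : X * (X - 1) ∈ G := by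
        have e : X * (X - 1) = (X * X - X - C a1 * X - C a2) + C a1 * X + C a2 := by ring
        rw [e]
        exact G.add_mem (G.add_mem (hqG.le hquadq) (G.mul_mem_right _ (hmG _ ha1))) (hmG _ ha2)
      refine (hG.mem_or_mem h5).resolve_left fun h6 => ?_
      have := hGn h6
      rw [hn1, eval_X] at this
      exact (Ideal.ne_top_iff_one _).mp (Ideal.IsPrime.ne_top inferInstance) this
    refine le_antisymm hGn fun f hf => ?_
    have h6 : X - C 1 ∣ f - C (f.eval 1) := X_sub_C_dvd_sub_C_eval
    obtain ⟨q, hq⟩ := h6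
    have e : f = (X - 1) * q + C (f.eval 1) := by
      rw [C_1] at hq; rw [← hq]; ring
    rw [e]
    exact G.add_mem (G.mul_mem_right _ hX1) (hmG _ hf)
  have hgp : (g1.map (C : D →+* D[X])).IsPrime := Ideal.isPrime_map_C_of_isPrime
  have hmp : (m.map (C : D →+* D[X])).IsPrime := Ideal.isPrime_map_C_of_isPrime
  have hbp : (⊥ : Ideal D[X]).IsPrime := Ideal.isPrime_bot
  have hmem : ∀ (I : Ideal D) (w : D), C w ∈ I.map (C : D →+* D[X]) → w ∈ I := by
    intro I w hw
    have := Ideal.mem_map_C_iff.mp hw 0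
    simpa using this
  have hmn1 : m.map C ≤ n1 := by
    rw [Ideal.map_le_iff_le_comap]
    intro w hw
    change C w ∈ n1
    rw [hn1]; simpa using hw
  have hXn1 : (X : D[X]) - 1 ∈ n1 := by rw [hn1]; simp
  refine LIC.catenary_contra hcat ⟨⊥, hbp⟩ ⟨𝔮, hqp⟩ ⟨n1, hn1p⟩ ⟨g1.map C, hgp⟩ ⟨m.map C, hmp⟩
    ⟨?_, ?_⟩ ⟨?_, ?_⟩ ?_ ?_ ?_
  · change ⊥ < 𝔮
    exact bot_lt_iff_ne_bot.mpr hq0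
  · rintro ⟨G, hG⟩ h1 h2
    have h1' : ⊥ < G := h1
    have h2' : G < 𝔮 := h2
    exact h1'.ne' (hcov1 G hG h2')
  · change 𝔮 < n1
    refine lt_of_le_of_ne hqn1 fun h0 => hx0n (hqC x0 ?_)
    rw [h0, hn1]; simpa using hg1le hx0
  · rintro ⟨G, hG⟩ h1 h2
    have h1' : 𝔮 < G := h1
    have h2' : G < n1 := h2
    exact h2'.ne (hcov2 G hG h1' h2'.le)
  · change ⊥ < g1.map C
    refine bot_lt_iff_ne_bot.mpr fun h0 => hx0n ?_
    have : C x0 ∈ g1.map (C : D →+* D[X]) := Ideal.mem_map_of_mem _ hx0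
    rw [h0] at this
    simpa using this
  · change g1.map C < m.map C
    refine lt_of_le_of_ne (Ideal.map_mono hg1le) fun h0 => hg1m (le_antisymm hg1le fun w hw => ?_)
    apply hmem
    rw [h0]
    exact Ideal.mem_map_of_mem _ hw
  · change m.map C < n1
    refine lt_of_le_of_ne hmn1 fun h0 => ?_
    rw [← h0] at hXn1
    have := Ideal.mem_map_C_iff.mp hXn1 1
    simp [coeff_one] at this
    exact (Ideal.ne_top_iff_one _).mp (Ideal.IsPrime.ne_top inferInstance) this


open scoped TensorProduct in
theorem LIC.quot_tmul {R A : Type*} [CommRing R] [CommRing A] [Algebra R A] (I : Ideal R) (a : A) :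
    (Ideal.Quotient.mk I 1 ⊗ₜ[R] a : (R ⧸ I) ⊗[R] A) = 0 ↔ a ∈ I.map (algebraMap R A) := by
  rw [← (TensorProduct.quotTensorEquivQuotSMul A I).map_eq_zero_iff,
    TensorProduct.quotTensorEquivQuotSMul_mk_tmul, Submodule.Quotient.mk_eq_zero, one_smul,
    Ideal.smul_top_eq_map]
  rfl

open scoped TensorProduct in
theorem LIC.tmul_quot {R A : Type*} [CommRing R] [CommRing A] [Algebra R A] (I : Ideal R) (a : A) :
    (a ⊗ₜ[R] Ideal.Quotient.mk I 1 : A ⊗[R] (R ⧸ I)) = 0 ↔ a ∈ I.map (algebraMap R A) := by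
  rw [← (TensorProduct.tensorQuotEquivQuotSMul A I).map_eq_zero_iff,
    TensorProduct.tensorQuotEquivQuotSMul_tmul_mk, Submodule.Quotient.mk_eq_zero, one_smul,
    Ideal.smul_top_eq_map]
  rfl

open scoped TensorProduct in
theorem LIC.fibre1 {R A : Type*} [CommRing R] [CommRing A] [Algebra R A]
    [Module.Flat R A] (p : Ideal R) [p.IsPrime] (P : Ideal A) [P.IsPrime]
    (hPp : P.comap (algebraMap R A) = p)
    (hdom : ∀ (q : Ideal (FractionRing (R ⧸ p) ⊗[R] A)) [q.IsPrime],
      IsDomain (Localization.AtPrime q))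
    (z a : A) (hza : z * a ∈ p.map (algebraMap R A)) :
    (∃ σ ∉ P, σ * z ∈ p.map (algebraMap R A)) ∨ (∃ σ ∉ P, σ * a ∈ p.map (algebraMap R A)) := by
  let K := FractionRing (R ⧸ p)
  let Q := FractionRing (A ⧸ P)
  have hle : p ≤ P.comap (algebraMap R A) := hPp.ge
  let g0 : R ⧸ p →+* A ⧸ P := Ideal.quotientMap P (algebraMap R A) hle
  have hg0 : Function.Injective g0 := Ideal.quotientMap_injective' hPp.le
  let g : R ⧸ p →+* Q := (algebraMap (A ⧸ P) Q).comp g0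
  have hg : Function.Injective g := (IsFractionRing.injective (A ⧸ P) Q).comp hg0
  let f1 : K →+* Q := IsFractionRing.lift hg
  let f1a : K →ₐ[R] Q := { f1 with
    commutes' := fun r => by
      change f1 (algebraMap R K r) = _
      rw [IsScalarTower.algebraMap_apply R (R ⧸ p) K]
      simp only [f1]
      rw [IsFractionRing.lift_algebraMap]
      rw [IsScalarTower.algebraMap_apply R A Q, IsScalarTower.algebraMap_apply A (A ⧸ P) Q]
      rfl }
  let φ : K ⊗[R] A →ₐ[R] Q := Algebra.TensorProduct.lift f1a (IsScalarTower.toAlgHom R A Q)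
    (fun _ _ => Commute.all _ _)
  let PF : Ideal (K ⊗[R] A) := RingHom.ker φ
  have hPF : PF.IsPrime := RingHom.ker_isPrime φ
  have hPFa : ∀ a : A, (1 ⊗ₜ[R] a : K ⊗[R] A) ∈ PF ↔ a ∈ P := by
    intro a
    rw [RingHom.mem_ker]
    simp only [φ]
    rw [Algebra.TensorProduct.lift_tmul, map_one, one_mul]
    change algebraMap A Q a = 0 ↔ _
    rw [IsScalarTower.algebraMap_apply A (A ⧸ P) Q]
    rw [FaithfulSMul.algebraMap_eq_zero_iff]
    exact Ideal.Quotient.eq_zero_iff_mem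
  -- zero in the tensor product
  have hzero : ∀ a : A, (1 ⊗ₜ[R] a : K ⊗[R] A) = 0 ↔ a ∈ p.map (algebraMap R A) := by
    intro a
    rw [← LIC.quot_tmul p a]
    let l : R ⧸ p →ₗ[R] K := (IsScalarTower.toAlgHom R (R ⧸ p) K).toLinearMap
    have hl : Function.Injective l := IsFractionRing.injective (R ⧸ p) K
    have := Module.Flat.rTensor_preserves_injective_linearMap (M := A) l hl
    rw [← map_eq_zero_iff _ this]
    rw [LinearMap.rTensor_tmul]
    have e : l (Ideal.Quotient.mk p 1) = 1 := by simp [l]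
    rw [e]
  -- every element is a unit multiple of a pure tensor
  have hpure : ∀ f : K ⊗[R] A, ∃ (d : K) (a : A), d ≠ 0 ∧ (d ⊗ₜ[R] 1) * f = 1 ⊗ₜ[R] a := by
    intro f
    induction f using TensorProduct.induction_on with
    | zero => exact ⟨1, 0, one_ne_zero, by simp⟩
    | tmul k a =>
      obtain ⟨x, y, hy, rfl⟩ := IsFractionRing.div_surjective (A := R ⧸ p) k
      obtain ⟨x, rfl⟩ := Ideal.Quotient.mk_surjective x
      refine ⟨algebraMap (R ⧸ p) K y, x • a, ?_, ?_⟩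
      · simpa using nonZeroDivisors.ne_zero hy
      · have hy0 : algebraMap (R ⧸ p) K y ≠ 0 := by simpa using nonZeroDivisors.ne_zero hy
        rw [Algebra.TensorProduct.tmul_mul_tmul, one_mul, mul_div_cancel₀ _ hy0, ← TensorProduct.smul_tmul,
          Algebra.smul_def, mul_one, IsScalarTower.algebraMap_apply R (R ⧸ p) K]
        rfl
    | add x y hx hy =>
      obtain ⟨d, a, hd, h1⟩ := hx
      obtain ⟨e, b, he, h2⟩ := hy
      obtain ⟨dx, dy, hdy, hd'⟩ := IsFractionRing.div_surjective (A := R ⧸ p) d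
      obtain ⟨ex, ey, hey, he'⟩ := IsFractionRing.div_surjective (A := R ⧸ p) e
      obtain ⟨dx, rfl⟩ := Ideal.Quotient.mk_surjective dx
      obtain ⟨ex, rfl⟩ := Ideal.Quotient.mk_surjective ex
      have hdy0 : algebraMap (R ⧸ p) K dy ≠ 0 := by simpa using nonZeroDivisors.ne_zero hdy
      have hey0 : algebraMap (R ⧸ p) K ey ≠ 0 := by simpa using nonZeroDivisors.ne_zero hey
      have ed : algebraMap (R ⧸ p) K dy * d = algebraMap R K dx := by
        rw [← hd', mul_div_cancel₀ _ hdy0]; rfl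
      have ee : algebraMap (R ⧸ p) K ey * e = algebraMap R K ex := by
        rw [← he', mul_div_cancel₀ _ hey0]; rfl
      obtain ⟨dy, rfl⟩ := Ideal.Quotient.mk_surjective dy
      obtain ⟨ey, rfl⟩ := Ideal.Quotient.mk_surjective ey
      have key : ∀ r : R, (algebraMap R K r ⊗ₜ[R] (1 : A)) = 1 ⊗ₜ[R] algebraMap R A r := by
        intro r
        rw [Algebra.algebraMap_eq_smul_one, Algebra.algebraMap_eq_smul_one, TensorProduct.smul_tmul]
      have m1 : ∀ k l : K, ((k * l) ⊗ₜ[R] (1 : A)) = (k ⊗ₜ[R] 1) * (l ⊗ₜ[R] 1) := by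
        intro k l; simp
      have m2 : ∀ k l : A, ((1 : K) ⊗ₜ[R] (k * l)) = ((1:K) ⊗ₜ[R] k) * (1 ⊗ₜ[R] l) := by
        intro k l; simp
      -- multiply by dx * ex
      have hdx : algebraMap R K dx ≠ 0 := by rw [← ed]; exact mul_ne_zero hdy0 hd
      have hex : algebraMap R K ex ≠ 0 := by rw [← ee]; exact mul_ne_zero hey0 he
      have ed' : algebraMap R K dy * d = algebraMap R K dx := ed
      have ee' : algebraMap R K ey * e = algebraMap R K ex := ee
      refine ⟨algebraMap R K dx * algebraMap R K ex, algebraMap R A ex * algebraMap R A dy * a +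
        algebraMap R A dx * algebraMap R A ey * b, mul_ne_zero hdx hex, ?_⟩
      rw [TensorProduct.tmul_add, m2, m2, m2, m2, ← h1, ← h2, ← key, ← key, ← key, ← key, m1,
        ← ed', ← ee', m1, m1]
      ring
  have hinj : ∀ a : A, algebraMap (K ⊗[R] A) (Localization.AtPrime PF) (1 ⊗ₜ[R] a) = 0 →
      ∃ σ ∉ P, σ * a ∈ p.map (algebraMap R A) := by
    intro a ha
    obtain ⟨⟨f, hf⟩, h⟩ := (IsLocalization.map_eq_zero_iff PF.primeCompl _ _).mp ha
    obtain ⟨d, a', hd, h1⟩ := hpure f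
    refine ⟨a', fun h2 => hf ?_, ?_⟩
    · rw [← hPFa, ← h1] at h2
      refine (hPF.mem_or_mem h2).resolve_left fun h3 => hPF.ne_top (Ideal.eq_top_of_isUnit_mem _ h3 ?_)
      exact IsUnit.of_mul_eq_one (d⁻¹ ⊗ₜ[R] 1) (by
        rw [Algebra.TensorProduct.tmul_mul_tmul, mul_inv_cancel₀ hd, one_mul,
          Algebra.TensorProduct.one_def])
    · rw [← hzero]
      have m2 : ∀ k l : A, ((1 : K) ⊗ₜ[R] (k * l)) = ((1:K) ⊗ₜ[R] k) * (1 ⊗ₜ[R] l) := by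
        intro k l; simp
      rw [m2, ← h1, mul_assoc]
      have h' : f * (1 ⊗ₜ[R] a) = 0 := h
      rw [h', mul_zero]
  have := hdom PF
  have e : algebraMap (K ⊗[R] A) (Localization.AtPrime PF) (1 ⊗ₜ[R] z) *
    algebraMap (K ⊗[R] A) (Localization.AtPrime PF) (1 ⊗ₜ[R] a) = 0 := by
    rw [← map_mul, Algebra.TensorProduct.tmul_mul_tmul, one_mul, (hzero _).mpr hza, map_zero]
  rcases mul_eq_zero.mp e with h | h
  · exact Or.inl (hinj z h)
  · exact Or.inr (hinj a h)

open scoped TensorProduct in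
theorem LIC.fibre2 {R A : Type*} [CommRing R] [IsNoetherianRing R] [CommRing A] [Algebra R A]
    [Module.Flat R A] (p : Ideal R) (hp : p ∈ minimalPrimes R) (P : Ideal A) [hP : P.IsPrime]
    (hPp : P.comap (algebraMap R A) = p) (z : A)
    (H : ∀ a : A, z * a ∈ p.map (algebraMap R A) → ∃ σ ∉ P, σ * a ∈ p.map (algebraMap R A))
    (r : A) (hzr : z * r = 0) : ∃ σ ∉ P, σ * r = 0 := by
  have main0 : ∀ (N : Type _) [AddCommGroup N] [Module R N] (_ : Module.Finite R N) (ξ : A ⊗[R] N),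
      z • ξ = 0 → ∃ σ ∉ P, σ • ξ = 0 := by
    intro N _ _ hN
    induction hN using
      IsNoetherianRing.induction_on_isQuotientEquivQuotientPrime R with
    | subsingleton N =>
      intro ξ _
      refine ⟨1, (Ideal.ne_top_iff_one _).mp hP.ne_top, ?_⟩
      have : Subsingleton (A ⊗[R] N) := inferInstance
      exact Subsingleton.elim _ _
    | quotient N q e =>
      have key : ∀ ξ : A ⊗[R] (R ⧸ q.1), z • ξ = 0 → ∃ σ ∉ P, σ • ξ = 0 := by
        intro ξ hξ
        obtain ⟨a, rfl⟩ : ∃ a : A, a ⊗ₜ[R] Ideal.Quotient.mk q.1 1 = ξ := by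
          clear hξ
          induction ξ using TensorProduct.induction_on with
          | zero => exact ⟨0, by simp⟩
          | tmul a x =>
            obtain ⟨x, rfl⟩ := Ideal.Quotient.mk_surjective x
            refine ⟨x • a, ?_⟩
            rw [TensorProduct.smul_tmul]
            congr 1
            rw [map_one, Algebra.smul_def, mul_one]; rfl
          | add x y hx hy =>
            obtain ⟨a, rfl⟩ := hx
            obtain ⟨b, rfl⟩ := hy
            exact ⟨a + b, TensorProduct.add_tmul _ _ _⟩
        rw [TensorProduct.smul_tmul', smul_eq_mul, LIC.tmul_quot] at hξ
        simp only [TensorProduct.smul_tmul', smul_eq_mul, LIC.tmul_quot]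
        by_cases hq : q.1 ≤ p
        · have : q.1 = p := le_antisymm hq (hp.2 ⟨q.2, bot_le⟩ hq)
          rw [this] at hξ ⊢
          exact H a hξ
        · obtain ⟨g, hgq, hgp⟩ := Set.not_subset.mp hq
          refine ⟨algebraMap R A g, fun h => hgp ?_, Ideal.mul_mem_right _ _ (Ideal.mem_map_of_mem _ hgq)⟩
          rw [← hPp]; exact h
      intro ξ hξ
      have e' := e.baseChange R A N (R ⧸ q.1)
      obtain ⟨σ, hσ, h⟩ := key (e' ξ) (by rw [← map_smul, hξ, map_zero])
      refine ⟨σ, hσ, ?_⟩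
      rw [← map_smul] at h
      exact e'.map_eq_zero_iff.mp h
    | exact N₁ N₂ N₃ f g hf hg hfg h₁ h₃ =>
      intro ξ hξ
      obtain ⟨σ, hσ, h⟩ := h₃ (g.baseChange A ξ) (by rw [← map_smul, hξ, map_zero])
      rw [← map_smul] at h
      have hex := lTensor_exact A hfg hg
      have hinj := Module.Flat.lTensor_preserves_injective_linearMap (M := A) f hf
      rw [← LinearMap.baseChange_eq_ltensor] at hinj
      rw [← LinearMap.baseChange_eq_ltensor, ← LinearMap.baseChange_eq_ltensor] at hex
      obtain ⟨η, hη⟩ := (hex _).mp h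
      obtain ⟨σ', hσ', h'⟩ := h₁ η (by
        apply hinj
        rw [map_smul, hη, map_zero, smul_comm, hξ, smul_zero])
      refine ⟨σ' * σ, fun h => (hP.mem_or_mem h).elim hσ' hσ, ?_⟩
      rw [mul_smul, ← hη, ← map_smul, h', map_zero]
  obtain ⟨σ, hσ, h⟩ := main0 R inferInstance (r ⊗ₜ[R] 1) (by rw [TensorProduct.smul_tmul', smul_eq_mul, hzr, TensorProduct.zero_tmul])
  refine ⟨σ, hσ, ?_⟩
  have := congrArg (TensorProduct.rid R A) h
  simpa [TensorProduct.smul_tmul'] using this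

open scoped TensorProduct in
theorem LIC.fibre {R A : Type*} [CommRing R] [IsNoetherianRing R] [CommRing A] [IsNoetherianRing A]
    [Algebra R A] [Module.Flat R A] (p : Ideal R) [p.IsPrime] (hp : p ∈ minimalPrimes R)
    (P : Ideal A) [hP : P.IsPrime]
    (hPp : P.comap (algebraMap R A) = p)
    (hdom : ∀ (q : Ideal (FractionRing (R ⧸ p) ⊗[R] A)) [q.IsPrime],
      IsDomain (Localization.AtPrime q))
    (r : A) (hr : ∀ z, z ∈ P ↔ z * r = 0) :
    ∃ s ∉ P, ∀ z ∈ P, s * z ∈ p.map (algebraMap R A) := by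
  have h1 : ∀ z ∈ P, ∃ σ ∉ P, σ * z ∈ p.map (algebraMap R A) := by
    intro z hz
    by_contra hcon
    obtain ⟨σ, hσ, h⟩ := LIC.fibre2 p hp P hPp z
      (fun a ha => (LIC.fibre1 p P hPp hdom z a ha).resolve_left hcon) r ((hr z).mp hz)
    exact hσ ((hr σ).mpr h)
  obtain ⟨S, hS⟩ := Ideal.fg_of_isNoetherianRing P
  have hSP : ∀ z ∈ S, z ∈ P := fun z hz => by rw [← hS]; exact Submodule.subset_span hz
  choose! σ hσ hσz using h1
  refine ⟨∏ z ∈ S, σ z, fun h => ?_, fun z hz => ?_⟩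
  · obtain ⟨z, hz, h⟩ := (hP.prod_mem_iff).mp h
    exact hσ z (hSP z hz) h
  · rw [← hS] at hz
    induction hz using Submodule.span_induction with
    | mem z hz =>
      obtain ⟨w, hw⟩ := Finset.dvd_prod_of_mem σ hz
      rw [hw, mul_right_comm]
      exact Ideal.mul_mem_right _ _ (hσz z (hSP z hz))
    | zero => simp
    | add x y _ _ hx hy => rw [mul_add]; exact Ideal.add_mem _ hx hy
    | smul a x _ hx => rw [smul_eq_mul, mul_left_comm]; exact Ideal.mul_mem_left _ _ hx


theorem LIC.krull_closed {A : Type*} [CommRing A] [IsNoetherianRing A] [IsLocalRing A]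
    (I : Ideal A) (hI : I ≤ maximalIdeal A) (J : Ideal A) (x : A) (h : ∀ k, x ∈ J ⊔ I ^ k) : x ∈ J := by
  have := IsHausdorff.of_le_jacobson (I := I) (M := A ⧸ J)
    (hI.trans (IsLocalRing.maximalIdeal_le_jacobson _))
  have h1 := this.haus (Ideal.Quotient.mk J x) (fun k => by
    rw [SModEq.zero]
    obtain ⟨a, ha, b, hb, hab⟩ := Submodule.mem_sup.mp (h k)
    have e : Ideal.Quotient.mk J x = b • Ideal.Quotient.mk J 1 := by
      rw [← hab, map_add, Ideal.Quotient.eq_zero_iff_mem.mpr ha, zero_add, map_one,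
        Algebra.smul_def, mul_one]; rfl
    rw [e]
    exact Submodule.smul_mem_smul hb trivial)
  exact Ideal.Quotient.eq_zero_iff_mem.mp h1

section
variable {R : Type u} [CommRing R] [IsLocalRing R]
    (E : Type u) [AddCommGroup E] [Module R E]
    (j : (R ⧸ IsLocalRing.maximalIdeal R) →ₗ[R] E)

theorem LIC.range_torsion (e : E) (he : e ∈ LinearMap.range j) (x : R) (hx : x ∈ maximalIdeal R) :
    x • e = 0 := by
  obtain ⟨y, rfl⟩ := he
  obtain ⟨y, rfl⟩ := Ideal.Quotient.mk_surjective y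
  rw [← map_smul]
  have : x • Ideal.Quotient.mk (maximalIdeal R) y = 0 := by
    rw [Algebra.smul_def]
    change Ideal.Quotient.mk _ x * _ = 0
    rw [Ideal.Quotient.eq_zero_iff_mem.mpr hx, zero_mul]
  rw [this, map_zero]

theorem LIC.ess_elt (hess : ∀ N : Submodule R E, N ⊓ LinearMap.range j = ⊥ → N = ⊥)
    (e : E) (he : e ≠ 0) : ∃ b : R, b • e ≠ 0 ∧ b • e ∈ LinearMap.range j := by
  by_contra! hcon
  have := hess (Submodule.span R {e}) (by
    rw [eq_bot_iff]
    rintro y ⟨hy1, hy2⟩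
    obtain ⟨b, rfl⟩ := Submodule.mem_span_singleton.mp hy1
    by_contra h
    exact hcon b h hy2)
  exact he (by simpa using this)

theorem LIC.socle (hess : ∀ N : Submodule R E, N ⊓ LinearMap.range j = ⊥ → N = ⊥)
    (e : E) (he : ∀ x ∈ maximalIdeal R, x • e = 0) : e ∈ LinearMap.range j := by
  by_cases h0 : e = 0
  · rw [h0]; exact Submodule.zero_mem _
  obtain ⟨b, hb, hbr⟩ := LIC.ess_elt E j hess e h0
  have hbu : IsUnit b := by
    by_contra h
    exact hb (he b h)
  obtain ⟨u, rfl⟩ := hbu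
  have := Submodule.smul_mem _ (↑u⁻¹ : R) hbr
  simpa [smul_smul] using this

theorem LIC.torsion (hess : ∀ N : Submodule R E, N ⊓ LinearMap.range j = ⊥ → N = ⊥)
    [IsNoetherianRing R] (e : E) :
    ∃ k : ℕ, ∀ x ∈ maximalIdeal R ^ k, x • e = 0 := by
  let I : Ideal R := LinearMap.ker (LinearMap.toSpanSingleton R E e)
  have hI : ∀ x, x ∈ I ↔ x • e = 0 := fun x => by simp [I]
  have h1 : maximalIdeal R ≤ I.radical := by
    intro x hx
    let c : ℕ →o Ideal R := ⟨fun n => LinearMap.ker (LinearMap.toSpanSingleton R E (x ^ n • e)), by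
      refine monotone_nat_of_le_succ fun n y hy => ?_
      simp only [LinearMap.mem_ker, LinearMap.toSpanSingleton_apply] at hy ⊢
      rw [pow_succ', mul_smul, smul_comm, hy, smul_zero]⟩
    obtain ⟨n, hn⟩ := monotone_stabilizes_iff_noetherian.mpr (inferInstance : IsNoetherian R R) c
    refine ⟨n, ?_⟩
    rw [hI]
    by_contra h0
    obtain ⟨b, hb, hbr⟩ := LIC.ess_elt E j hess _ h0
    have h2 := LIC.range_torsion E j _ hbr x hx
    have h3 : b ∈ c (n + 1) := by
      simp only [c, OrderHom.coe_mk, LinearMap.mem_ker, LinearMap.toSpanSingleton_apply]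
      rw [pow_succ', mul_smul, smul_comm, h2]
    rw [← hn (n + 1) (Nat.le_succ n)] at h3
    simp only [c, OrderHom.coe_mk, LinearMap.mem_ker, LinearMap.toSpanSingleton_apply] at h3
    exact hb h3
  obtain ⟨k, hk⟩ := Ideal.exists_pow_le_of_le_radical_of_fg h1 (Ideal.fg_of_isNoetherianRing _)
  exact ⟨k, fun x hx => (hI x).mp (hk hx)⟩

theorem LIC.cogen (hj : Function.Injective j)
    [Module.Injective R E] (M : Type u) [AddCommGroup M] [Module R M] (v : M)
    (hv : v ≠ 0) : ∃ f : M →ₗ[R] E, f v ≠ 0 := by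
  let I : Ideal R := LinearMap.ker (LinearMap.toSpanSingleton R M v)
  have hI : I ≤ maximalIdeal R := by
    apply IsLocalRing.le_maximalIdeal
    rw [Ideal.ne_top_iff_one]
    simpa [I] using hv
  let f : R ⧸ I →ₗ[R] M := Submodule.liftQ I (LinearMap.toSpanSingleton R M v) le_rfl
  have hf : Function.Injective f := by
    rw [← LinearMap.ker_eq_bot]
    exact Submodule.ker_liftQ_eq_bot' _ _ rfl
  let g : R ⧸ I →ₗ[R] E := j ∘ₗ Submodule.factor hI
  obtain ⟨h, hh⟩ := Module.Injective.out f hf g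
  refine ⟨h, ?_⟩
  have e : f (Submodule.Quotient.mk 1) = v :=
    (Submodule.liftQ_apply _ _ _).trans (by simp)
  rw [← e, hh]
  simp only [g, LinearMap.comp_apply]
  rw [map_ne_zero_iff _ hj]
  change Ideal.Quotient.mk (maximalIdeal R) 1 ≠ 0
  rw [Ne, Ideal.Quotient.eq_zero_iff_mem]
  exact (Ideal.ne_top_iff_one _).mp (Ideal.IsPrime.ne_top inferInstance)

theorem LIC.cogen_ideal (hj : Function.Injective j)
    [Module.Injective R E] (I : Ideal R) (a : R)
    (h : ∀ e : E, (∀ i ∈ I, i • e = 0) → a • e = 0) : a ∈ I := by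
  by_contra ha
  obtain ⟨f, hf⟩ := LIC.cogen E j hj (R ⧸ I) (Ideal.Quotient.mk I a)
    (by rwa [Ne, Ideal.Quotient.eq_zero_iff_mem])
  have hmk : ∀ x : R, f (Ideal.Quotient.mk I x) = x • f (Ideal.Quotient.mk I 1) := by
    intro x
    rw [← map_smul, Algebra.smul_def, map_one, mul_one]; rfl
  apply hf
  rw [hmk]
  refine h _ fun i hi => ?_
  rw [← hmk, Ideal.Quotient.eq_zero_iff_mem.mpr hi, map_zero]

theorem LIC.factor_surj {X Y Z : Type*} [AddCommGroup X] [Module R X] [AddCommGroup Y] [Module R Y]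
    [AddCommGroup Z] [Module R Z] (π : X →ₗ[R] Y) (hπ : Function.Surjective π) (g : X →ₗ[R] Z)
    (h : ∀ x, π x = 0 → g x = 0) : ∃ g' : Y →ₗ[R] Z, ∀ x, g' (π x) = g x := by
  refine ⟨(Submodule.liftQ (LinearMap.ker π) g (fun x hx => h x hx)) ∘ₗ
    (LinearMap.quotKerEquivOfSurjective π hπ).symm.toLinearMap, fun x => ?_⟩
  have : (LinearMap.quotKerEquivOfSurjective π hπ).symm (π x) = Submodule.Quotient.mk x := by
    rw [LinearEquiv.symm_apply_eq]; rfl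
  simp only [LinearMap.comp_apply, LinearEquiv.coe_coe, this]
  exact Submodule.liftQ_apply _ _ _

theorem LIC.bidual (hj : Function.Injective j)
    (hess : ∀ N : Submodule R E, N ⊓ LinearMap.range j = ⊥ → N = ⊥)
    [IsNoetherianRing R] [Module.Injective R E] (k : ℕ)
    (M : Type u) [AddCommGroup M] [Module R M] (hM : Module.Finite R M)
    (hk : ∀ x ∈ maximalIdeal R ^ k, ∀ v : M, x • v = 0)
    (Ψ : (M →ₗ[R] E) →ₗ[R] E) : ∃ v : M, ∀ f, Ψ f = f v := by
  induction hM using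
      IsNoetherianRing.induction_on_isQuotientEquivQuotientPrime R with
  | subsingleton N =>
    refine ⟨0, fun f => ?_⟩
    have : f = 0 := by ext x; rw [Subsingleton.elim x 0]; simp
    simp [this]
  | quotient N q e =>
    obtain ⟨q, hq⟩ := q
    simp only at e
    have hqm : q = maximalIdeal R := by
      refine le_antisymm (IsLocalRing.le_maximalIdeal hq.ne_top) ?_
      have h1 : maximalIdeal R ^ k ≤ q := by
        intro x hx
        have h2 := hk x hx (e.symm (Ideal.Quotient.mk q 1))
        rw [← map_smul, LinearEquiv.map_eq_zero_iff, Algebra.smul_def, map_one, mul_one] at h2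
        exact Ideal.Quotient.eq_zero_iff_mem.mp h2
      exact hq.le_of_pow_le h1
    subst hqm
    -- generator
    have hN : ∀ x ∈ maximalIdeal R, ∀ v : N, x • v = 0 := by
      intro x hx v
      apply e.injective
      rw [map_smul, map_zero]
      obtain ⟨y, hy⟩ := Ideal.Quotient.mk_surjective (e v)
      rw [← hy, Algebra.smul_def]
      change Ideal.Quotient.mk _ x * _ = 0
      rw [Ideal.Quotient.eq_zero_iff_mem.mpr hx, zero_mul]
    let j' : N →ₗ[R] E := j ∘ₗ e.toLinearMap
    obtain ⟨c0, hc0⟩ := LIC.socle E j hess (Ψ j') (fun x hx => by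
      rw [← map_smul]
      have : x • j' = 0 := by
        ext v
        simp only [LinearMap.smul_apply, LinearMap.zero_apply]
        rw [← map_smul, hN x hx, map_zero]
      rw [this, map_zero])
    refine ⟨e.symm c0, fun f => ?_⟩
    obtain ⟨c, hc⟩ := LIC.socle E j hess (f (e.symm (Ideal.Quotient.mk _ 1))) (fun x hx => by
      rw [← map_smul, hN x hx, map_zero])
    obtain ⟨c, rfl⟩ := Ideal.Quotient.mk_surjective c
    have hf : f = c • j' := by
      ext v
      obtain ⟨y, hy⟩ := Ideal.Quotient.mk_surjective (e v)
      have h1 : v = y • e.symm (Ideal.Quotient.mk _ 1) := by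
        rw [← map_smul, LinearEquiv.eq_symm_apply, ← hy, Algebra.smul_def, map_one, mul_one]; rfl
      rw [h1, map_smul, ← hc, map_smul]
      congr 1
      simp only [j', LinearMap.smul_apply, LinearMap.comp_apply, LinearEquiv.coe_coe,
        LinearEquiv.apply_symm_apply]
      rw [← map_smul, Algebra.smul_def, map_one, mul_one]; rfl
    rw [hf, map_smul, ← hc0]
    simp [j']
  | exact N₁ N₂ N₃ f g hf hg hfg h₁ h₃ =>
    have hk1 : ∀ x ∈ maximalIdeal R ^ k, ∀ v : N₁, x • v = 0 := fun x hx v => hf (by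
      rw [map_smul, hk x hx, map_zero])
    have hk3 : ∀ x ∈ maximalIdeal R ^ k, ∀ v : N₃, x • v = 0 := fun x hx v => by
      obtain ⟨v, rfl⟩ := hg v
      rw [← map_smul, hk x hx, map_zero]
    obtain ⟨n3, hn3⟩ := h₃ hk3 (Ψ ∘ₗ LinearMap.lcomp R E g)
    obtain ⟨n2, rfl⟩ := hg n3
    let π : (N₂ →ₗ[R] E) →ₗ[R] (N₁ →ₗ[R] E) := LinearMap.lcomp R E f
    have hπ : Function.Surjective π := by
      intro h
      obtain ⟨h', hh'⟩ := Module.Injective.out f hf h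
      exact ⟨h', LinearMap.ext hh'⟩
    let Ψ' : (N₂ →ₗ[R] E) →ₗ[R] E := Ψ - LinearMap.applyₗ n2
    obtain ⟨Ψ'', hΨ''⟩ := LIC.factor_surj π hπ Ψ' (by
      intro h hh
      obtain ⟨h3, hh3⟩ := LIC.factor_surj g hg h (by
        intro x hx
        obtain ⟨y, rfl⟩ := (hfg x).mp hx
        exact LinearMap.congr_fun hh y)
      have e : h = LinearMap.lcomp R E g h3 := LinearMap.ext fun x => (hh3 x).symm
      have h4 := hn3 h3
      simp only [LinearMap.comp_apply] at h4
      simp only [Ψ', LinearMap.sub_apply, LinearMap.applyₗ_apply_apply]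
      rw [e, h4]
      simp)
    obtain ⟨n1, hn1⟩ := h₁ hk1 Ψ''
    refine ⟨n2 + f n1, fun h => ?_⟩
    have h5 := hΨ'' h
    rw [hn1] at h5
    simp only [Ψ', π, LinearMap.sub_apply, LinearMap.applyₗ_apply_apply, LinearMap.lcomp_apply] at h5
    rw [map_add, h5]
    abel

theorem LIC.endo (hj : Function.Injective j)
    (hess : ∀ N : Submodule R E, N ⊓ LinearMap.range j = ⊥ → N = ⊥)
    [IsNoetherianRing R] [Module.Injective R E] (φ : E →ₗ[R] E) (k : ℕ) :
    ∃ r : R, ∀ e : E, (∀ x ∈ maximalIdeal R ^ k, x • e = 0) → φ e = r • e := by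
  let M := R ⧸ maximalIdeal R ^ k
  obtain ⟨v, hv⟩ := LIC.bidual E j hj hess k M inferInstance (by
    intro x hx v
    obtain ⟨y, rfl⟩ := Ideal.Quotient.mk_surjective v
    rw [Algebra.smul_def]
    change Ideal.Quotient.mk _ x * _ = 0
    rw [Ideal.Quotient.eq_zero_iff_mem.mpr hx, zero_mul])
    (φ ∘ₗ LinearMap.applyₗ (Ideal.Quotient.mk _ 1))
  obtain ⟨r, rfl⟩ := Ideal.Quotient.mk_surjective v
  refine ⟨r, fun e he => ?_⟩
  let f : M →ₗ[R] E := Submodule.liftQ _ (LinearMap.toSpanSingleton R E e) (fun x hx => by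
    simpa using he x hx)
  have hfm : ∀ x : R, f (Ideal.Quotient.mk _ x) = x • e := by
    intro x
    exact (Submodule.liftQ_apply _ _ _)
  have := hv f
  simp only [LinearMap.comp_apply, LinearMap.applyₗ_apply_apply] at this
  rw [hfm, hfm, one_smul] at this
  exact this

theorem LIC.matlis (hj : Function.Injective j)
    (hess : ∀ N : Submodule R E, N ⊓ LinearMap.range j = ⊥ → N = ⊥)
    [IsNoetherianRing R] [Module.Injective R E] (T : Submodule R E) (hT : T ≠ ⊤)
    (A : Type u) [CommRing A] [Algebra R A] [IsNoetherianRing A] [IsLocalRing A]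
    (hm : (maximalIdeal R).map (algebraMap R A) ≤ maximalIdeal A)
    (hcon : ∀ (k : ℕ) (x : R), algebraMap R A x ∈ (maximalIdeal R ^ k).map (algebraMap R A) →
      x ∈ maximalIdeal R ^ k)
    (hcompl : ∀ r : ℕ → R, (∀ k, r (k + 1) - r k ∈ maximalIdeal R ^ k) →
      ∃ a : A, ∀ k, a - algebraMap R A (r k) ∈ (maximalIdeal R ^ k).map (algebraMap R A)) :
    ∃ r : A, r ≠ 0 ∧ ∀ (I : Ideal R) (a : R), (∀ e : E, (∀ i ∈ I, i • e = 0) → a • e ∈ T) →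
      r * algebraMap R A a ∈ I.map (algebraMap R A) := by
  obtain ⟨e0, he0⟩ : ∃ e0, e0 ∉ T := by
    by_contra! h
    exact hT (eq_top_iff.mpr fun x _ => h x)
  obtain ⟨ψ, hψ⟩ := LIC.cogen E j hj (E ⧸ T) (Submodule.Quotient.mk e0)
    (by rwa [Ne, Submodule.Quotient.mk_eq_zero])
  let φ : E →ₗ[R] E := ψ ∘ₗ T.mkQ
  have hφT : ∀ e ∈ T, φ e = 0 := by
    intro e he
    simp only [φ, LinearMap.comp_apply, Submodule.mkQ_apply]
    rw [(Submodule.Quotient.mk_eq_zero T).mpr he, map_zero]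
  choose r hr using LIC.endo E j hj hess φ
  obtain ⟨a0, ha0⟩ := hcompl r (by
    intro k
    apply LIC.cogen_ideal E j hj
    intro e he
    rw [sub_smul, ← hr k e he, ← hr (k + 1) e (fun x hx => he x (Ideal.pow_le_pow_right (Nat.le_succ k) hx)), sub_self])
  refine ⟨a0, ?_, ?_⟩
  · rintro rfl
    obtain ⟨k, hk⟩ := LIC.torsion E j hess e0
    have h1 := ha0 k
    rw [zero_sub, Ideal.neg_mem_iff] at h1
    apply hψ
    have h2 := hr k e0 hk
    rw [hk _ (hcon k _ h1)] at h2
    exact h2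
  · intro I a hIa
    refine LIC.krull_closed _ hm _ _ fun k => ?_
    rw [← Ideal.map_pow]
    have h1 : r k * a ∈ I ⊔ maximalIdeal R ^ k := by
      apply LIC.cogen_ideal E j hj
      intro e he
      have hek : ∀ x ∈ maximalIdeal R ^ k, x • e = 0 := fun x hx => he x (Ideal.mem_sup_right hx)
      rw [mul_smul, ← hr k]
      · exact hφT _ (hIa e fun i hi => he i (Ideal.mem_sup_left hi))
      · intro x hx
        rw [smul_comm, hek x hx, smul_zero]
    have h2 := Ideal.mem_map_of_mem (algebraMap R A) h1
    rw [Ideal.map_sup, map_mul] at h2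
    have e : a0 * algebraMap R A a = algebraMap R A (r k) * algebraMap R A a +
      (a0 - algebraMap R A (r k)) * algebraMap R A a := by ring
    rw [e]
    exact Ideal.add_mem _ h2 (Ideal.mem_sup_right (Ideal.mul_mem_right _ _ (ha0 k)))
end


theorem LIC.lic_mem {R : Type*} [CommRing R] {E : Type*} [AddCommGroup E] [Module R E]
    (x w : R) (n : ℕ) (e : E) (hx : x ^ (n + 1) • e = 0) (hw : w ^ (n + 1) • e = 0) :
    (x * w ^ n) • e ∈ LIC.lic (⊥ : Submodule R E) := by
  refine ⟨Finsupp.single e (x * w ^ n), ?_, by rw [Finsupp.linearCombination_single]; rfl⟩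
  change IsIntegral _ _
  refine IsIntegral.of_pow (n := n + 1) (Nat.succ_pos n) ?_
  set S := Algebra.adjoin R (LIC.symEmb R E '' (Submodule.comap
    (Finsupp.linearCombination R (id : E → E)) ⊥ : Submodule R (E →₀ R))) with hS
  have hsym : ∀ a : R, LIC.symEmb R E (Finsupp.single e a) = MvPolynomial.C a * MvPolynomial.X e := by
    intro a
    simp [LIC.symEmb, MvPolynomial.smul_eq_C_mul]
  have hmem : ∀ a : R, a • e = 0 → MvPolynomial.C a * MvPolynomial.X e ∈ S := by
    intro a ha
    rw [← hsym]
    refine Algebra.subset_adjoin ⟨_, ?_, rfl⟩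
    simpa using ha
  have h1 : (LIC.symEmb R E (Finsupp.single e (x * w ^ n))) ^ (n + 1) =
      (MvPolynomial.C (x ^ (n + 1)) * MvPolynomial.X e) *
      (MvPolynomial.C (w ^ (n + 1)) * MvPolynomial.X e) ^ n := by
    rw [hsym]
    simp only [map_mul, map_pow]
    ring
  rw [h1]
  exact isIntegral_algebraMap (x := (⟨_, S.mul_mem (hmem _ hx) (S.pow_mem (hmem _ hw) n)⟩ : S))

theorem LIC.zd_le_minimal {R : Type*} [CommRing R] [IsNoetherianRing R]
    (hemb : LIC.HasNoEmbeddedPrimes R) (I : Ideal R) (hI : ∀ d ∈ I, d ∉ nonZeroDivisors R) :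
    ∃ q ∈ minimalPrimes R, I ≤ q := by
  have h1 : (I : Set R) ⊆ ⋃ p ∈ associatedPrimes R R, (p : Set R) := by
    rw [biUnion_associatedPrimes_eq_zero_divisors]
    intro d hd
    have := hI d hd
    rw [mem_nonZeroDivisors_iff_right] at this
    push Not at this
    obtain ⟨y, hy, hy0⟩ := this
    exact ⟨y, hy0, by rw [smul_eq_mul, mul_comm]; exact hy⟩
  obtain ⟨q, hq, hle⟩ := (Ideal.subset_union_prime_finite (f := id) (associatedPrimes.finite R R) ⊥ ⊥
    (fun i hi _ _ => hi.1)).mp h1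
  exact ⟨q, hemb q hq, hle⟩

theorem LIC.minimal_of_le {R : Type*} [CommRing R] (p q : Ideal R) (hp : p.IsPrime)
    (hq : q ∈ minimalPrimes R) (h : p ≤ q) : p ∈ minimalPrimes R := by
  have : q ≤ p := hq.2 ⟨hp, bot_le⟩ h
  rwa [le_antisymm h this]

/-- saturation step -/
theorem LIC.sat_step {A : Type*} [CommRing A] [IsNoetherianRing A] [IsLocalRing A]
    (r x y : A) (n : ℕ) (hy : y ∈ maximalIdeal A) (hx : x ∈ nonZeroDivisors A)
    (h : ∀ N : ℕ, r * (x * (y ^ N) ^ n) ∈ Ideal.span {x ^ (n + 1), (y ^ N) ^ (n + 1)}) :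
    ∃ c : ℕ, ∃ a, y ^ c * r = x ^ n * a := by
  let C : Ideal A :=
    { carrier := {a | ∃ k : ℕ, x ^ (n + 1) ∣ y ^ k * a}
      zero_mem' := ⟨0, by simp⟩
      add_mem' := by
        rintro a b ⟨k, hk⟩ ⟨l, hl⟩
        refine ⟨k + l, ?_⟩
        have e : y ^ (k + l) * (a + b) = y ^ l * (y ^ k * a) + y ^ k * (y ^ l * b) := by ring
        rw [e]
        exact dvd_add (hk.mul_left _) (hl.mul_left _)
      smul_mem' := by
        rintro c a ⟨k, hk⟩
        refine ⟨k, ?_⟩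
        rw [smul_eq_mul, mul_left_comm]
        exact hk.mul_left _ }
  have h1 : r * x ∈ C := by
    refine LIC.krull_closed (Ideal.span {y}) (by rw [Ideal.span_le]; simpa using hy) C _ fun N => ?_
    obtain ⟨a, b, hab⟩ := Ideal.mem_span_pair.mp (h N)
    rw [Ideal.span_singleton_pow]
    have e : r * x = (r * x - y ^ N * b) + y ^ N * b := by ring
    rw [e]
    refine Ideal.add_mem _ (Ideal.mem_sup_left ⟨N * n, a, ?_⟩)
      (Ideal.mem_sup_right (Ideal.mul_mem_right _ _ (Ideal.mem_span_singleton_self _)))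
    rw [pow_mul]
    linear_combination - hab
  obtain ⟨c, a, hca⟩ := h1
  refine ⟨c, a, ?_⟩
  have h2 : (y ^ c * r - x ^ n * a) * x = 0 := by linear_combination hca
  have := (mem_nonZeroDivisors_iff_right.mp hx) _ h2
  linear_combination this

theorem LIC.artin_rees {A : Type*} [CommRing A] [IsNoetherianRing A] (x r : A) :
    ∃ n : ℕ, ∀ a b, b * r = x ^ n * a → ∃ β, b * r = x * β * r := by
  obtain ⟨k, hk⟩ := Ideal.exists_pow_inf_eq_pow_smul (Ideal.span {x}) (Ideal.span {r} : Submodule A A)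
  refine ⟨k + 1, fun a b h => ?_⟩
  have h1 := hk (k + 1) (Nat.le_succ k)
  rw [Nat.add_sub_cancel_left, pow_one] at h1
  have h2 : b * r ∈ Ideal.span {x} ^ (k + 1) • (⊤ : Submodule A A) ⊓ (Ideal.span {r} : Submodule A A) := by
    refine ⟨?_, Ideal.mul_mem_left _ _ (Ideal.mem_span_singleton_self _)⟩
    rw [h, Ideal.span_singleton_pow]
    exact Submodule.smul_mem_smul (Ideal.mem_span_singleton_self _) trivial
  rw [h1] at h2
  have h3 := Submodule.smul_mono (le_refl (Ideal.span {x})) inf_le_right h2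
  rw [smul_eq_mul, Ideal.span_singleton_mul_span_singleton, Ideal.mem_span_singleton'] at h3
  obtain ⟨β, hβ⟩ := h3
  exact ⟨β, by rw [← hβ]; ring⟩

theorem LIC.dim_one {A : Type*} [CommRing A] [IsNoetherianRing A] [IsLocalRing A]
    (P : Ideal A) [hP : P.IsPrime] (x : A) (hxu : x ∈ maximalIdeal A)
    (hx : maximalIdeal A ≤ (P ⊔ Ideal.span {x}).radical)
    (z : A) (hz : z ∉ P) : ∃ τ : ℕ, maximalIdeal A ^ τ ≤ P ⊔ Ideal.span {z} := by
  apply Ideal.exists_pow_le_of_le_radical_of_fg _ (Ideal.fg_of_isNoetherianRing _)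
  rw [Ideal.radical_eq_sInf, le_sInf_iff]
  rintro Q ⟨hQ, hQp⟩
  have hPQ : P ≤ Q := le_sup_left.trans hQ
  have hzQ : z ∈ Q := hQ (Ideal.mem_sup_right (Ideal.mem_span_singleton_self z))
  have hQm := IsLocalRing.le_maximalIdeal hQp.ne_top
  let π := Ideal.Quotient.mk P
  have hπ : Function.Surjective π := Ideal.Quotient.mk_surjective
  have hker : RingHom.ker π = P := Ideal.mk_ker
  let M' := (maximalIdeal A).map π
  have hPm : P ≤ maximalIdeal A := IsLocalRing.le_maximalIdeal hP.ne_top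
  have hM' : M'.IsPrime := Ideal.map_isPrime_of_surjective hπ (hker.trans_le hPm)
  have hcm : ∀ I : Ideal A, P ≤ I → (I.map π).comap π = I := by
    intro I hI
    rw [Ideal.comap_map_of_surjective _ hπ]
    exact sup_eq_left.mpr (hker.trans_le hI)
  have hmin : M' ∈ (Ideal.span {π x}).minimalPrimes := by
    have hxm : π x ∈ M' → Ideal.span {π x} ≤ M' := fun h => by rw [Ideal.span_le]; simpa using h
    refine ⟨⟨hM', hxm (Ideal.mem_map_of_mem _ hxu)⟩, ?_⟩
    rintro G ⟨hG, hxG⟩ _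
    rw [Ideal.map_le_iff_le_comap]
    refine hx.trans ((hG.comap π).radical_le_iff.mpr (sup_le ?_ ?_))
    · intro a ha
      change π a ∈ G
      rw [Ideal.Quotient.eq_zero_iff_mem.mpr ha]; exact G.zero_mem
    · rw [Ideal.span_le]
      simpa using hxG (Ideal.mem_span_singleton_self _)
  have hht := Ideal.height_le_one_of_isPrincipal_of_mem_minimalPrimes _ _ hmin
  have hQ' : (Q.map π).IsPrime := Ideal.map_isPrime_of_surjective hπ (hker.trans_le hPQ)
  by_contra hne
  have hlt : Q.map π < M' := by
    refine lt_of_le_of_ne (Ideal.map_mono hQm) fun h => hne ?_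
    rw [← hcm Q hPQ, h, hcm _ hPm]
  have h1 := (Ideal.height_strict_mono_of_isPrime hlt).trans_le hht
  have h2 : (Q.map π).height = 0 := by simpa using h1
  rw [Ideal.height_eq_zero_iff_eq_bot] at h2
  have h3 : π z ∈ Q.map π := Ideal.mem_map_of_mem _ hzQ
  rw [h2] at h3
  exact hz (Ideal.Quotient.eq_zero_iff_mem.mp h3)

theorem LIC.assoc_multiple {A : Type*} [CommRing A] [IsNoetherianRing A] (r : A) (hr : r ≠ 0) :
    ∃ c : A, c * r ≠ 0 ∧ ∃ P : Ideal A, P.IsPrime ∧ ∀ z, z ∈ P ↔ z * (c * r) = 0 := by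
  have : Nontrivial (Ideal.span {r} : Ideal A) := by
    rw [Submodule.nontrivial_iff_ne_bot]
    simpa using hr
  obtain ⟨P, hP⟩ := associatedPrimes.nonempty A (Ideal.span {r} : Ideal A)
  obtain ⟨hPp, ⟨y, hy⟩, hPy⟩ := isAssociatedPrime_iff.mp hP
  obtain ⟨c, rfl⟩ := Ideal.mem_span_singleton'.mp hy
  have h1 : ∀ z, z ∈ P ↔ z * (c * r) = 0 := by
    intro z
    rw [hPy, Submodule.mem_colon_singleton]
    rw [Submodule.mem_bot, Subtype.ext_iff]
    rfl
  refine ⟨c, fun h0 => hPp.ne_top ?_, P, hPp, h1⟩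
  rw [Ideal.eq_top_iff_one, h1, h0, mul_zero]

theorem LIC.contract {R A : Type*} [CommRing R] [IsNoetherianRing R] [IsLocalRing R] [CommRing A]
    [Algebra R A]
    (hden : ∀ (k : ℕ) (a : A), ∃ r : R, a - algebraMap R A r ∈
      (maximalIdeal R ^ k).map (algebraMap R A))
    (hcon : ∀ (k : ℕ) (x : R), algebraMap R A x ∈ (maximalIdeal R ^ k).map (algebraMap R A) →
      x ∈ maximalIdeal R ^ k) (I : Ideal R) (x : R)
    (hx : algebraMap R A x ∈ I.map (algebraMap R A)) : x ∈ I := by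
  refine LIC.krull_closed (maximalIdeal R) le_rfl I x fun k => ?_
  have h1 : ∀ a ∈ I.map (algebraMap R A), ∃ i ∈ I, a - algebraMap R A i ∈
      (maximalIdeal R ^ k).map (algebraMap R A) := by
    intro a ha
    induction ha using Submodule.span_induction with
    | mem a ha =>
      obtain ⟨i, hi, rfl⟩ := ha
      exact ⟨i, hi, by simp⟩
    | zero => exact ⟨0, I.zero_mem, by simp⟩
    | add a b _ _ ha hb =>
      obtain ⟨i, hi, h⟩ := ha
      obtain ⟨i', hi', h'⟩ := hb
      refine ⟨i + i', I.add_mem hi hi', ?_⟩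
      have e : a + b - algebraMap R A (i + i') = (a - algebraMap R A i) + (b - algebraMap R A i') := by
        rw [map_add]; ring
      rw [e]; exact Ideal.add_mem _ h h'
    | smul c a _ ha =>
      obtain ⟨i, hi, h⟩ := ha
      obtain ⟨d, hd⟩ := hden k c
      refine ⟨d * i, I.mul_mem_left _ hi, ?_⟩
      have e : c • a - algebraMap R A (d * i) = c * (a - algebraMap R A i) +
        algebraMap R A i * (c - algebraMap R A d) := by
        rw [map_mul, smul_eq_mul]; ring
      rw [e]
      exact Ideal.add_mem _ (Ideal.mul_mem_left _ _ h) (Ideal.mul_mem_left _ _ hd)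
  obtain ⟨i, hi, h⟩ := h1 _ hx
  rw [← map_sub] at h
  have := hcon k _ h
  have e : x = i + (x - i) := by ring
  rw [e]
  exact Submodule.add_mem_sup hi this

open scoped TensorProduct in
open Polynomial in
theorem LIC.core {R : Type u} [CommRing R] [IsLocalRing R] [IsNoetherianRing R]
    (hcat : LIC.IsUniversallyCatenary.{u} R)
    (hdim : 2 ≤ ringKrullDim R)
    (hequi : LIC.IsEquidimensionalRing R)
    (hemb : LIC.HasNoEmbeddedPrimes R)
    (E : Type u) [AddCommGroup E] [Module R E] [Module.Injective R E]
    (j : (R ⧸ IsLocalRing.maximalIdeal R) →ₗ[R] E) (hj : Function.Injective j)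
    (hess : ∀ N : Submodule R E, N ⊓ LinearMap.range j = ⊥ → N = ⊥)
    (A : Type u) [CommRing A] [Algebra R A] [IsNoetherianRing A] [IsLocalRing A] [Module.Flat R A]
    (hm : (maximalIdeal R).map (algebraMap R A) = maximalIdeal A)
    (hden : ∀ (k : ℕ) (a : A), ∃ r : R, a - algebraMap R A r ∈
      (maximalIdeal R ^ k).map (algebraMap R A))
    (hcon : ∀ (k : ℕ) (x : R), algebraMap R A x ∈ (maximalIdeal R ^ k).map (algebraMap R A) →
      x ∈ maximalIdeal R ^ k)
    (hcompl : ∀ r : ℕ → R, (∀ k, r (k + 1) - r k ∈ maximalIdeal R ^ k) →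
      ∃ a : A, ∀ k, a - algebraMap R A (r k) ∈ (maximalIdeal R ^ k).map (algebraMap R A))
    (hfib : ∀ (P : Ideal A) (_ : P.IsPrime), P.comap (algebraMap R A) ∈ minimalPrimes R →
      ∀ r : A, (∀ z, z ∈ P ↔ z * r = 0) →
        ∃ s ∉ P, ∀ z ∈ P, s * z ∈ (P.comap (algebraMap R A)).map (algebraMap R A)) :
    LIC.lic (⊥ : Submodule R E) = ⊤ := by
  by_contra hT
  obtain ⟨r0, hr0, hr0T⟩ := LIC.matlis E j hj hess _ hT A hm.le hcon hcompl
  obtain ⟨c0, hr, P, hP, hPr⟩ := LIC.assoc_multiple r0 hr0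
  set r := c0 * r0 with hrdef
  have hrT : ∀ (x w : R) (n : ℕ), r * (algebraMap R A x * algebraMap R A w ^ n) ∈
      Ideal.span {algebraMap R A x ^ (n + 1), algebraMap R A w ^ (n + 1)} := by
    intro x w n
    have h1 := hr0T (Ideal.span {x ^ (n + 1), w ^ (n + 1)}) (x * w ^ n) (fun e he =>
      LIC.lic_mem x w n e (he _ (Ideal.subset_span (by simp))) (he _ (Ideal.subset_span (by simp))))
    rw [Ideal.map_span, Set.image_pair] at h1
    simp only [map_mul, map_pow] at h1
    rw [hrdef, mul_assoc]
    exact Ideal.mul_mem_left _ _ h1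
  have hmm : ∀ y ∈ maximalIdeal R, algebraMap R A y ∈ maximalIdeal A := fun y hy => by
    rw [← hm]; exact Ideal.mem_map_of_mem _ hy
  have hreg : ∀ x ∈ nonZeroDivisors R, ∀ a : A, algebraMap R A x * a = 0 → a = 0 := by
    intro x hx a ha
    apply (Module.Flat.isSMulRegular_of_nonZeroDivisors hx : IsSMulRegular A x)
    simp only [Algebra.smul_def, mul_zero]
    exact ha
  -- a nonzerodivisor in the maximal ideal
  obtain ⟨x, hxm, hx⟩ : ∃ x ∈ maximalIdeal R, x ∈ nonZeroDivisors R := by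
    by_contra! h
    obtain ⟨q, hq, hle⟩ := LIC.zd_le_minimal hemb _ h
    have h1 := LIC.minimal_of_le _ _ inferInstance hq hle
    have h2 : (maximalIdeal R).height = 0 := Ideal.height_eq_zero_iff.mpr h1
    rw [← IsLocalRing.maximalIdeal_height_eq_ringKrullDim, h2] at hdim
    revert hdim
    decide
  -- dim A/P ≤ 1
  have hrad : maximalIdeal A ≤ (P ⊔ Ideal.span {algebraMap R A x}).radical := by
    rw [← hm, Ideal.map_le_iff_le_comap]
    intro y hy
    change algebraMap R A y ∈ (P ⊔ Ideal.span {algebraMap R A x}).radical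
    obtain ⟨n, hn⟩ := LIC.artin_rees (algebraMap R A x) r
    obtain ⟨c, a, hca⟩ := LIC.sat_step r (algebraMap R A x) (algebraMap R A y) n (hmm y hy)
      (mem_nonZeroDivisors_iff_right.mpr fun a ha => hreg x hx a (by rw [mul_comm]; exact ha))
      (fun N => by
        have := hrT x (y ^ N) n
        rwa [map_pow] at this)
    obtain ⟨β, hβ⟩ := hn _ _ hca
    refine ⟨c, ?_⟩
    have h1 : algebraMap R A y ^ c - algebraMap R A x * β ∈ P := by
      rw [hPr]; linear_combination hβ
    have e : algebraMap R A y ^ c = (algebraMap R A y ^ c - algebraMap R A x * β) +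
      algebraMap R A x * β := by ring
    rw [e]
    exact Submodule.add_mem_sup h1 (Ideal.mul_mem_right _ _ (Ideal.mem_span_singleton_self _))
  have hone := LIC.dim_one P (algebraMap R A x) (hmm x hxm) hrad
  -- p
  set p := P.comap (algebraMap R A) with hp
  have hpp : p.IsPrime := hP.comap _
  have hpmin : p ∈ minimalPrimes R := by
    obtain ⟨q, hq, hle⟩ := LIC.zd_le_minimal hemb p (fun d hd hd' => hr (hreg d hd' _ ((hPr _).mp hd)))
    exact LIC.minimal_of_le _ _ hpp hq hle
  obtain ⟨s, hsP, hs⟩ := hfib P hP hpmin r hPr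
  have hD2 : 2 ≤ ringKrullDim (R ⧸ p) := by rw [hequi p hpmin]; exact hdim
  have hIcon := LIC.contract hden hcon
  -- set up D and B
  let D := R ⧸ p
  let B := D ⊗[R] A
  have hpm : p ≤ maximalIdeal R := IsLocalRing.le_maximalIdeal hpp.ne_top
  have : IsLocalRing D := IsLocalRing.of_surjective' (Ideal.Quotient.mk p) Ideal.Quotient.mk_surjective
  let q : R →+* D := Ideal.Quotient.mk p
  have hq : Function.Surjective q := Ideal.Quotient.mk_surjective
  let β : A →+* B := (Algebra.TensorProduct.includeRight : A →ₐ[R] D ⊗[R] A).toRingHom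
  have hβa : ∀ a, β a = 1 ⊗ₜ[R] a := fun a => rfl
  have hβs : Function.Surjective β := by
    intro b
    induction b using TensorProduct.induction_on with
    | zero => exact ⟨0, map_zero _⟩
    | tmul d a =>
      obtain ⟨d, rfl⟩ := hq d
      refine ⟨d • a, ?_⟩
      rw [hβa, ← TensorProduct.smul_tmul, Algebra.smul_def, mul_one]
      rfl
    | add b c hb hc =>
      obtain ⟨b, rfl⟩ := hb
      obtain ⟨c, rfl⟩ := hc
      exact ⟨b + c, map_add _ _ _⟩
  have hβk : ∀ a, β a = 0 ↔ a ∈ p.map (algebraMap R A) := by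
    intro a
    rw [← LIC.quot_tmul p a, hβa, map_one]
  have hcomp : (algebraMap D B).comp q = β.comp (algebraMap R A) := by
    ext y
    change q y ⊗ₜ[R] (1 : A) = 1 ⊗ₜ[R] algebraMap R A y
    rw [Algebra.algebraMap_eq_smul_one, ← TensorProduct.smul_tmul, Algebra.smul_def, mul_one]
    rfl
  have hcompa : ∀ y, algebraMap D B (q y) = β (algebraMap R A y) := fun y => RingHom.congr_fun hcomp y
  have hmapI : ∀ I : Ideal R, (I.map q).map (algebraMap D B) = (I.map (algebraMap R A)).map β := by
    intro I
    rw [Ideal.map_map, Ideal.map_map, hcomp]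
  have hmD : maximalIdeal D = (maximalIdeal R).map q := by
    have h1 : ((maximalIdeal R).map q).IsMaximal := by
      refine (Ideal.map_eq_top_or_isMaximal_of_surjective q hq inferInstance).resolve_left fun h => ?_
      have h2 : (1 : D) ∈ (maximalIdeal R).map q := by rw [h]; trivial
      obtain ⟨y, hy, hy1⟩ := (Ideal.mem_map_iff_of_surjective q hq).mp h2
      have h3 : y - 1 ∈ p := by
        rw [← Ideal.Quotient.eq_zero_iff_mem, map_sub, map_one]
        exact sub_eq_zero.mpr hy1
      have h4 := (maximalIdeal R).sub_mem hy (hpm h3)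
      rw [sub_sub_cancel] at h4
      exact (Ideal.ne_top_iff_one _).mp (Ideal.IsPrime.ne_top inferInstance) h4
    exact (IsLocalRing.eq_maximalIdeal h1).symm
  have hmDk : ∀ k, (maximalIdeal D ^ k).map (algebraMap D B) = (maximalIdeal A ^ k).map β := by
    intro k
    rw [hmD, ← Ideal.map_pow, hmapI, Ideal.map_pow, hm]
  have hpP : p.map (algebraMap R A) ≤ P := Ideal.map_le_iff_le_comap.mpr le_rfl
  have hβker : RingHom.ker β ≤ P := fun a ha => hpP ((hβk a).mp ha)
  let P' := P.map β
  have hP'p : P'.IsPrime := Ideal.map_isPrime_of_surjective hβs hβker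
  have hmemP' : ∀ a, β a ∈ P' ↔ a ∈ P := by
    intro a
    refine ⟨fun h => ?_, fun h => Ideal.mem_map_of_mem _ h⟩
    have h1 : a ∈ P'.comap β := h
    rw [Ideal.comap_map_of_surjective _ hβs] at h1
    exact (sup_le le_rfl hβker) h1
  have hsup : ∀ z : A, z ∉ P → ∃ t : ℕ, (maximalIdeal D ^ t).map (algebraMap D B) ≤
      P' ⊔ Ideal.span {β z} := by
    intro z hz
    obtain ⟨t, ht⟩ := hone z hz
    refine ⟨t, ?_⟩
    rw [hmDk]
    refine (Ideal.map_mono ht).trans ?_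
    rw [Ideal.map_sup, Ideal.map_span, Set.image_singleton]
  obtain ⟨t, ht⟩ := hsup s hsP
  -- middle prime
  obtain ⟨l, hl⟩ := Order.le_krullDim_iff.mp (show ((2 : ℕ) : WithBot ℕ∞) ≤ Order.krullDim (PrimeSpectrum D)
    from hD2)
  have hl01 : l.toFun ⟨0, by omega⟩ < l.toFun ⟨1, by omega⟩ := l.strictMono (by rw [Fin.lt_def]; norm_num)
  have hl12 : l.toFun ⟨1, by omega⟩ < l.toFun ⟨2, by omega⟩ := l.strictMono (by rw [Fin.lt_def]; norm_num)
  set g0 := l.toFun ⟨0, by omega⟩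
  set g1 := l.toFun ⟨1, by omega⟩
  set g2 := l.toFun ⟨2, by omega⟩
  have hl01' : g0.asIdeal < g1.asIdeal := hl01
  have hl12' : g1.asIdeal < g2.asIdeal := hl12
  refine LIC.ratliff (D := D) (B := B) ?_ ?_ P' hP'p ?_ ?_ (β s) ?_ t ht ?_ g1.asIdeal g1.2 ?_ ?_ ?_
  · intro k b
    obtain ⟨a, rfl⟩ := hβs b
    obtain ⟨y, hy⟩ := hden k a
    refine ⟨q y, ?_⟩
    rw [hcompa, ← map_sub, hmDk]
    apply Ideal.mem_map_of_mem
    rwa [Ideal.map_pow, hm] at hy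
  · intro I y hy
    obtain ⟨y, rfl⟩ := hq y
    rw [hcompa, ← Ideal.map_comap_of_surjective q hq I, hmapI] at hy
    have h1 : algebraMap R A y ∈ (((I.comap q).map (algebraMap R A)).map β).comap β := hy
    rw [Ideal.comap_map_of_surjective _ hβs] at h1
    have h2 : Ideal.comap β ⊥ ≤ (I.comap q).map (algebraMap R A) := by
      intro a ha
      refine Ideal.map_mono ?_ ((hβk a).mp ha)
      intro d hd
      change q d ∈ I
      rw [show q d = 0 from Ideal.Quotient.eq_zero_iff_mem.mpr hd]
      exact I.zero_mem
    exact hIcon (I.comap q) y ((sup_le le_rfl h2) h1)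
  · have := hmDk 1
    rw [pow_one, pow_one] at this
    rw [this]
    exact Ideal.map_mono (IsLocalRing.le_maximalIdeal hP.ne_top)
  · intro d hd
    obtain ⟨d, rfl⟩ := hq d
    rw [hcompa, hmemP'] at hd
    exact Ideal.Quotient.eq_zero_iff_mem.mpr hd
  · intro u hu
    obtain ⟨u, rfl⟩ := hβs u
    rw [hmemP'] at hu
    rw [← map_mul, hβk]
    exact hs u hu
  · intro g hg
    obtain ⟨g, rfl⟩ := hq g
    rw [hcompa]
    apply hsup
    intro h
    exact hg (Ideal.Quotient.eq_zero_iff_mem.mpr h)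
  · exact (bot_le.trans_lt hl01').ne'
  · exact (hl12'.trans_le (IsLocalRing.le_maximalIdeal g2.2.ne_top)).ne
  · exact hcat D[X] inferInstance inferInstance inferInstance

theorem LIC.finite_frac {D K L : Type*} [CommRing D] [Field K] [Field L] [Algebra D K]
    [Algebra D L] [IsFractionRing D K] [IsFractionRing D L] [Algebra K L] [IsScalarTower D K L] :
    FiniteDimensional K L := by
  have hsurj : Function.Surjective (algebraMap K L) := by
    intro z
    obtain ⟨a, b, hb, rfl⟩ := IsFractionRing.div_surjective (A := D) z
    refine ⟨algebraMap D K a / algebraMap D K b, ?_⟩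
    rw [map_div₀, ← IsScalarTower.algebraMap_apply, ← IsScalarTower.algebraMap_apply]
  exact Module.Finite.of_surjective (Algebra.linearMap K L) hsurj

open scoped TensorProduct in
theorem LIC.fibre_domain {S A : Type u} [CommRing S] [CommRing A] [Algebra S A]
    (hS : LIC.HasGeometricallyRegularFibers.{u} S A) (p : Ideal S) [hp : p.IsPrime]
    (q : Ideal (FractionRing (S ⧸ p) ⊗[S] A)) [hq : q.IsPrime] :
    IsDomain (Localization.AtPrime q) := by
  have hnz : NoZeroSMulDivisors (S ⧸ p) (FractionRing (S ⧸ p)) := by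
    refine ⟨fun {c z} h => ?_⟩
    rw [Algebra.smul_def, mul_eq_zero] at h
    exact h.imp_left fun h => (IsFractionRing.injective (S ⧸ p) (FractionRing (S ⧸ p)))
      (by rw [h, map_zero])
  have h := hS p hp (FractionRing (S ⧸ p)) inferInstance inferInstance hnz inferInstance
    inferInstance (by
      let := FractionRing.liftAlgebra (S ⧸ p) (FractionRing (S ⧸ p))
      have hst := FractionRing.isScalarTower_liftAlgebra (S ⧸ p) (FractionRing (S ⧸ p))
      exact @LIC.finite_frac (S ⧸ p) (FractionRing (S ⧸ p)) (FractionRing (S ⧸ p)) _ _ _ _ _ _ _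
        (FractionRing.liftAlgebra (S ⧸ p) (FractionRing (S ⧸ p))) hst)
  obtain ⟨hN, hL, s, hs, hc⟩ := h q hq
  exact LIC.regular_domain_aux _ _ s hs rfl hc

theorem LIC.final_aux {R : Type u} [CommRing R] [IsLocalRing R] [IsNoetherianRing R]
    (hcat : LIC.IsUniversallyCatenary.{u} R)
    (hdim : 2 ≤ ringKrullDim R)
    (hequi : LIC.IsEquidimensionalRing R)
    (hemb : LIC.HasNoEmbeddedPrimes R)
    (E : Type u) [AddCommGroup E] [Module R E] [Module.Injective R E]
    (j : (R ⧸ IsLocalRing.maximalIdeal R) →ₗ[R] E) (hj : Function.Injective j)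
    (hess : ∀ N : Submodule R E, N ⊓ LinearMap.range j = ⊥ → N = ⊥)
    (S : Type u) [CommRing S] [Algebra R S] [IsNoetherianRing S] [IsLocalRing S] [Module.Flat R S]
    (hbij : Function.Bijective (algebraMap R S))
    (hS : LIC.HasGeometricallyRegularFibers.{u} S (AdicCompletion (maximalIdeal S) S)) :
    LIC.lic (⊥ : Submodule R E) = ⊤ := by
  let A := AdicCompletion (maximalIdeal S) S
  have hst : IsScalarTower R S A := inferInstance
  have hal : algebraMap R A = (algebraMap S A).comp (algebraMap R S) := IsScalarTower.algebraMap_eq R S A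
  have hA : IsNoetherianRing A := LIC.noeth_completion S
  have hfl : Module.Flat S A := AdicCompletion.flat_of_isNoetherian _
  have hflR : Module.Flat R A := Module.Flat.trans R S A
  have hinj := hbij.1
  have hsur := hbij.2
  have hmS : (maximalIdeal R).map (algebraMap R S) = maximalIdeal S := by
    refine IsLocalRing.eq_maximalIdeal ?_
    exact Ideal.map_isMaximal_of_equiv (RingEquiv.ofBijective _ hbij)
  have hmk : ∀ k, (maximalIdeal R ^ k).map (algebraMap R A) =
      (maximalIdeal S ^ k).map (algebraMap S A) := by
    intro k
    rw [hal, ← Ideal.map_map, Ideal.map_pow (algebraMap R S), hmS]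
  have hFG := (maximalIdeal S).fg_of_isNoetherianRing
  have hmem : ∀ k x, algebraMap R S x ∈ maximalIdeal S ^ k → x ∈ maximalIdeal R ^ k := by
    intro k x hx
    rw [← hmS, ← Ideal.map_pow] at hx
    obtain ⟨y, hy, hyx⟩ := (Ideal.mem_map_iff_of_surjective _ hsur).mp hx
    rwa [← hinj hyx]
  refine LIC.core hcat hdim hequi hemb E j hj hess A ?_ ?_ ?_ ?_ ?_
  · have := hmk 1
    rw [pow_one, pow_one] at this
    rw [this]
    exact AdicCompletion.maximalIdeal_eq_map.symm
  · intro k a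
    obtain ⟨s, hs⟩ := LIC.compl_density (maximalIdeal S) hFG k a
    obtain ⟨r, rfl⟩ := hsur s
    exact ⟨r, by rw [hmk]; exact hs⟩
  · intro k x hx
    rw [hmk] at hx
    exact hmem k x (LIC.compl_contract (maximalIdeal S) hFG k _ hx)
  · intro r hr
    obtain ⟨a, ha⟩ := LIC.compl_complete (maximalIdeal S) hFG (fun k => algebraMap R S (r k))
      (fun k => by
        rw [← map_sub, ← hmS, ← Ideal.map_pow]
        exact Ideal.mem_map_of_mem _ (hr k))
    exact ⟨a, fun k => by rw [hmk]; exact ha k⟩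
  · intro P hP hmin r hr
    have hPp : (P.comap (algebraMap S A)).IsPrime := hP.comap _
    have hcc : P.comap (algebraMap R A) = (P.comap (algebraMap S A)).comap (algebraMap R S) := by
      rw [hal, Ideal.comap_comap]
    have hmc : ∀ I : Ideal S, (I.comap (algebraMap R S)).map (algebraMap R S) = I :=
      fun I => Ideal.map_comap_of_surjective _ hsur I
    have hmin' : P.comap (algebraMap S A) ∈ minimalPrimes S := by
      refine ⟨⟨hPp, bot_le⟩, fun q hq hle => ?_⟩
      have h1 := hmin.2 (y := q.comap (algebraMap R S)) ⟨hq.1.comap _, bot_le⟩ (Ideal.comap_mono hle)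
      rw [hcc] at h1
      have h2 := Ideal.map_mono (f := algebraMap R S) h1
      rwa [hmc, hmc] at h2
    obtain ⟨s, hs, h⟩ := LIC.fibre (R := S) (A := A) _ hmin' P rfl
      (fun q hq => LIC.fibre_domain hS _ q) r hr
    refine ⟨s, hs, fun z hz => ?_⟩
    rw [hcc, hal, ← Ideal.map_map, hmc]
    exact h z hz

end Helpers

/-- Let `(R,m)` be an excellent Noetherian local ring of dimension at
least `2`, equidimensional and with no embedded primes, and let `E` be an injective hull
of the residue field `R/m` (an injective module containing `R/m` as an essential
submodule).  Then `lic(0,E) = E`. -/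
theorem lic_injectiveHull_eq_top {R : Type u} [CommRing R] [IsLocalRing R]
    [IsNoetherianRing R]
    (hexc : LIC.IsExcellentRing.{u} R)
    (hdim : 2 ≤ ringKrullDim R)
    (hequi : LIC.IsEquidimensionalRing R)
    (hemb : LIC.HasNoEmbeddedPrimes R)
    (E : Type u) [AddCommGroup E] [Module R E] [Module.Injective R E]
    (j : (R ⧸ IsLocalRing.maximalIdeal R) →ₗ[R] E) (hj : Function.Injective j)
    (hess : ∀ N : Submodule R E, N ⊓ LinearMap.range j = ⊥ → N = ⊥) :
    LIC.lic (⊥ : Submodule R E) = ⊤ := by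
  have hu : ∀ x : (IsLocalRing.maximalIdeal R).primeCompl, IsUnit (x : R) := fun x => by
    by_contra h
    exact x.2 ((IsLocalRing.mem_maximalIdeal _).mpr h)
  have hfl : Module.Flat R (Localization.AtPrime (IsLocalRing.maximalIdeal R)) :=
    IsLocalization.flat _ (IsLocalRing.maximalIdeal R).primeCompl
  have hN : IsNoetherianRing (Localization.AtPrime (IsLocalRing.maximalIdeal R)) :=
    IsLocalization.isNoetherianRing (IsLocalRing.maximalIdeal R).primeCompl _ inferInstance
  refine LIC.final_aux hexc.2.1 hdim hequi hemb E j hj hess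
    (Localization.AtPrime (IsLocalRing.maximalIdeal R)) ?_ (hexc.2.2.1 (IsLocalRing.maximalIdeal R) inferInstance)
  have hb := (IsLocalization.atUnits R (IsLocalRing.maximalIdeal R).primeCompl
    (S := Localization.AtPrime (IsLocalRing.maximalIdeal R)) (fun x hx => hu ⟨x, hx⟩)).bijective
  convert hb using 1
  ext x
  exact ((IsLocalization.atUnits R (IsLocalRing.maximalIdeal R).primeCompl
    (S := Localization.AtPrime (IsLocalRing.maximalIdeal R)) (fun x hx => hu ⟨x, hx⟩)).commutes x).symm
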